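/- Fix constants 0 < δ ≤ Δ, an integer k ≥ 3, and α ∈ (−1, 1). For every Alice value density v_A there exists a deterministic Alice strategy S_A for the repeated k-cut game (depending on α but not on the constant c below) such that: for every c > 0 there exist C > 0 and T₀ ∈ ℕ with the property that for every Bob value density v_B, every deterministic Bob strategy that guarantees regret at most c·T'^α for every horizon T', and every horizon T ≥ T₀, Alice's Stackelberg regret under S_A over horizon T is at most C·T^{(3+α)/4}·k^{3/4}·(log T)^{1/2}. -/

import Mathlib

open MeasureTheory Set

noncomputable section

attribute [local instance] Classical.propDecidable

/-- A value density: measurable, bounded in `[δ, Δ]` on `[0,1]`, integrating to 1 on `[0,1]`. -/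
def IsValueDensity (δ Δ : ℝ) (v : ℝ → ℝ) : Prop :=
  Measurable v ∧ (∀ x ∈ Set.Icc (0:ℝ) 1, v x ∈ Set.Icc δ Δ) ∧
    (∫ x in Set.Icc (0:ℝ) 1, v x) = 1

/-- The value of a piece `S` under density `v`. -/
def pieceVal (v : ℝ → ℝ) (S : Set ℝ) : ℝ := ∫ x in S, v x

/-- Extended cut points: `0, c 0, …, c (k-1), 1`. -/
def extCuts (k : ℕ) (c : Fin k → ℝ) : ℕ → ℝ := fun i =>
  if i = 0 then 0 else if h : i - 1 < k then c ⟨i - 1, h⟩ else 1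

/-- A valid vector of `k` cut points: nondecreasing, within `[0,1]`. -/
def ValidCuts (k : ℕ) (c : Fin k → ℝ) : Prop :=
  Monotone c ∧ ∀ i, c i ∈ Set.Icc (0:ℝ) 1

/-- The two pieces of the alternating partition induced by cuts `c`:
`true` gives the union of even-indexed intervals, `false` the odd-indexed ones. -/
def altPiece (k : ℕ) (c : Fin k → ℝ) (b : Bool) : Set ℝ :=
  ⋃ i ∈ Finset.range (k + 1),
    if decide (i % 2 = 0) = b then Set.Icc (extCuts k c i) (extCuts k c (i + 1)) else ∅

/-- Alice's Stackelberg value with `k` cuts: max of `V_A(Z_A)` over alternating partitions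
`(Z_A, Z_B)` induced by `k` cut points with `V_B(Z_B) ≥ 1/2`. -/
def stackelbergValue (k : ℕ) (vA vB : ℝ → ℝ) : ℝ :=
  sSup { u : ℝ | ∃ (c : Fin k → ℝ) (b : Bool), ValidCuts k c ∧
    1 / 2 ≤ pieceVal vB (altPiece k c (!b)) ∧ u = pieceVal vA (altPiece k c b) }

/-- A history of play: the list of (Alice's cuts, Bob's choice) in past rounds. -/
abbrev Hist (k : ℕ) := List ((Fin k → ℝ) × Bool)

/-- Alice's deterministic strategy: horizon and history ↦ next cut vector. -/
abbrev AliceStrategy (k : ℕ) := ℕ → Hist k → (Fin k → ℝ)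

/-- Bob's deterministic strategy: horizon, history, and Alice's current cuts ↦ choice. -/
abbrev BobStrategy (k : ℕ) := ℕ → Hist k → (Fin k → ℝ) → Bool

/-- The history of play after `t` rounds. -/
def playHist (k : ℕ) (SA : AliceStrategy k) (SB : BobStrategy k) (T : ℕ) : ℕ → Hist k
  | 0 => []
  | t + 1 =>
      let h := playHist k SA SB T t
      let cuts := SA T h
      h ++ [(cuts, SB T h cuts)]

/-- Alice's cuts in round `t` (0-indexed). -/
def roundCuts (k : ℕ) (SA : AliceStrategy k) (SB : BobStrategy k) (T t : ℕ) : Fin k → ℝ :=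
  SA T (playHist k SA SB T t)

/-- Bob's choice in round `t` (0-indexed). -/
def roundChoice (k : ℕ) (SA : AliceStrategy k) (SB : BobStrategy k) (T t : ℕ) : Bool :=
  SB T (playHist k SA SB T t) (roundCuts k SA SB T t)

/-- Alice's Stackelberg regret over horizon `T`: in each round she receives the value of
the piece Bob did not choose. -/
def aliceRegret (k : ℕ) (vA vB : ℝ → ℝ) (SA : AliceStrategy k) (SB : BobStrategy k)
    (T : ℕ) : ℝ :=
  ∑ t ∈ Finset.range T,
    (stackelbergValue k vA vB -
      pieceVal vA (altPiece k (roundCuts k SA SB T t) (!(roundChoice k SA SB T t))))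

/-- Bob's regret over horizon `T` relative to always choosing his preferred piece. -/
def bobRegret (k : ℕ) (vB : ℝ → ℝ) (SA : AliceStrategy k) (SB : BobStrategy k) (T : ℕ) : ℝ :=
  ∑ t ∈ Finset.range T,
    (max (pieceVal vB (altPiece k (roundCuts k SA SB T t) true))
        (pieceVal vB (altPiece k (roundCuts k SA SB T t) false)) -
      pieceVal vB (altPiece k (roundCuts k SA SB T t) (roundChoice k SA SB T t)))

/-- Bob's strategy guarantees regret at most `R T` against every Alice strategy and horizon. -/
def BobGuarantees (k : ℕ) (vB : ℝ → ℝ) (SB : BobStrategy k) (R : ℕ → ℝ) : Prop :=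
  ∀ (SA : AliceStrategy k) (T : ℕ), bobRegret k vB SA SB T ≤ R T

/-- The myopic Bob: chooses the piece of larger `V_B`-value, breaking ties towards
the piece of smaller `V_A`-value. -/
def myopicBob (k : ℕ) (vA vB : ℝ → ℝ) : BobStrategy k := fun _ _ c =>
  if pieceVal vB (altPiece k c false) < pieceVal vB (altPiece k c true) then true
  else if pieceVal vB (altPiece k c true) < pieceVal vB (altPiece k c false) then false
  else if pieceVal vA (altPiece k c true) ≤ pieceVal vA (altPiece k c false) then true
  else false

/-- Alice's strategy always produces valid cut vectors. -/
def AliceValid (k : ℕ) (SA : AliceStrategy k) : Prop := ∀ T h, ValidCuts k (SA T h)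


/-! ### Part 1: values of pieces through the cumulative function -/

/-- Cumulative value function. -/
def cumF (v : ℝ → ℝ) (x : ℝ) : ℝ := ∫ t in (0:ℝ)..x, v t

/-- Alternating sum of increments of `G` at the cuts. -/
def val (k : ℕ) (G : ℝ → ℝ) (c : Fin k → ℝ) (b : Bool) : ℝ :=
  ∑ i ∈ Finset.range (k + 1),
    if decide (i % 2 = 0) = b then G (extCuts k c (i + 1)) - G (extCuts k c i) else 0

lemma extCuts_mono {k : ℕ} {c : Fin k → ℝ} (hc : ValidCuts k c) : Monotone (extCuts k c) := by
  refine monotone_nat_of_le_succ ?_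
  intro n
  unfold extCuts
  rcases n with _ | n
  · simp only [if_true, Nat.add_eq_zero_iff]
    simp only [Nat.zero_add, one_ne_zero, and_false, if_false, Nat.sub_self]
    split_ifs with h
    · exact (hc.2 _).1
    · norm_num
  · simp only [Nat.add_eq_zero_iff, one_ne_zero, and_false, if_false, Nat.add_sub_cancel]
    split_ifs with h1 h2 h2
    · exact hc.1 (by simp)
    · exact (hc.2 _).2
    · omega
    · exact le_rfl

lemma extCuts_zero (k : ℕ) (c : Fin k → ℝ) : extCuts k c 0 = 0 := by simp [extCuts]

lemma extCuts_last (k : ℕ) (c : Fin k → ℝ) (n : ℕ) (h : k + 1 ≤ n) : extCuts k c n = 1 := by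
  unfold extCuts
  rw [if_neg (by omega), dif_neg (by omega)]

lemma extCuts_succ (k : ℕ) (c : Fin k → ℝ) (n : ℕ) (h : n < k) :
    extCuts k c (n + 1) = c ⟨n, h⟩ := by
  unfold extCuts
  rw [if_neg (by omega), dif_pos (by simpa using h)]
  simp

lemma extCuts_mem {k : ℕ} {c : Fin k → ℝ} (hc : ValidCuts k c) (n : ℕ) :
    extCuts k c n ∈ Set.Icc (0:ℝ) 1 := by
  constructor
  · rw [← extCuts_zero k c]; exact extCuts_mono hc (Nat.zero_le _)
  · rw [← extCuts_last k c (max n (k+1)) (le_max_right _ _)]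
    exact extCuts_mono hc (le_max_left _ _)

lemma dens_integrable {δ Δ : ℝ} {v : ℝ → ℝ} (hv : IsValueDensity δ Δ v) :
    IntegrableOn v (Set.Icc (0:ℝ) 1) := by
  refine MeasureTheory.IntegrableOn.of_bound (C := max |δ| |Δ|) (by simp) hv.1.aestronglyMeasurable ?_
  refine (ae_restrict_iff' measurableSet_Icc).2 (Filter.Eventually.of_forall fun x hx => ?_)
  have := hv.2.1 x hx
  exact abs_le_max_abs_abs this.1 this.2

lemma dens_ii {δ Δ : ℝ} {v : ℝ → ℝ} (hv : IsValueDensity δ Δ v) {x y : ℝ}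
    (hx : x ∈ Set.Icc (0:ℝ) 1) (hy : y ∈ Set.Icc (0:ℝ) 1) : IntervalIntegrable v volume x y := by
  rw [intervalIntegrable_iff']
  exact (dens_integrable hv).mono_set (Set.uIcc_subset_Icc hx hy)

lemma cumF_sub {δ Δ : ℝ} {v : ℝ → ℝ} (hv : IsValueDensity δ Δ v) {x y : ℝ}
    (hx : x ∈ Set.Icc (0:ℝ) 1) (hy : y ∈ Set.Icc (0:ℝ) 1) :
    cumF v y - cumF v x = ∫ t in x..y, v t := by
  unfold cumF
  rw [intervalIntegral.integral_interval_sub_left]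
  · exact dens_ii hv (by simp) hy
  · exact dens_ii hv (by simp) hx

lemma cumF_zero (v : ℝ → ℝ) : cumF v 0 = 0 := by simp [cumF]

lemma cumF_one {δ Δ : ℝ} {v : ℝ → ℝ} (hv : IsValueDensity δ Δ v) : cumF v 1 = 1 := by
  unfold cumF
  rw [intervalIntegral.integral_of_le zero_le_one, ← integral_Icc_eq_integral_Ioc, hv.2.2]

lemma cumF_lower {δ Δ : ℝ} {v : ℝ → ℝ} (hv : IsValueDensity δ Δ v) {x y : ℝ}
    (hx : 0 ≤ x) (hxy : x ≤ y) (hy : y ≤ 1) : δ * (y - x) ≤ cumF v y - cumF v x := by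
  rw [cumF_sub hv ⟨hx, by linarith⟩ ⟨by linarith, hy⟩]
  have : ∫ t in x..y, δ = δ * (y - x) := by simp [mul_comm]
  rw [← this]
  apply intervalIntegral.integral_mono_on hxy (by simp) (dens_ii hv ⟨hx, by linarith⟩ ⟨by linarith, hy⟩)
  intro t ht
  exact (hv.2.1 t ⟨by linarith [ht.1], by linarith [ht.2]⟩).1

lemma cumF_upper {δ Δ : ℝ} {v : ℝ → ℝ} (hv : IsValueDensity δ Δ v) {x y : ℝ}
    (hx : 0 ≤ x) (hxy : x ≤ y) (hy : y ≤ 1) : cumF v y - cumF v x ≤ Δ * (y - x) := by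
  rw [cumF_sub hv ⟨hx, by linarith⟩ ⟨by linarith, hy⟩]
  have : ∫ t in x..y, Δ = Δ * (y - x) := by simp [mul_comm]
  rw [← this]
  apply intervalIntegral.integral_mono_on hxy (dens_ii hv ⟨hx, by linarith⟩ ⟨by linarith, hy⟩) (by simp)
  intro t ht
  exact (hv.2.1 t ⟨by linarith [ht.1], by linarith [ht.2]⟩).2

lemma pieceVal_eq {δ Δ : ℝ} {v : ℝ → ℝ} (hv : IsValueDensity δ Δ v) {k : ℕ} {c : Fin k → ℝ}
    (hc : ValidCuts k c) (b : Bool) : pieceVal v (altPiece k c b) = val k (cumF v) c b := by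
  unfold pieceVal altPiece val
  generalize k + 1 = n
  induction n with
  | zero => simp
  | succ n ih =>
    rw [Finset.sum_range_succ, Finset.range_add_one, Finset.set_biUnion_insert, Set.union_comm]
    set U : Set ℝ := ⋃ i ∈ Finset.range n, if decide (i % 2 = 0) = b then
      Set.Icc (extCuts k c i) (extCuts k c (i + 1)) else ∅ with hU
    have hmono := extCuts_mono hc
    have hUs : U ⊆ Set.Icc 0 (extCuts k c n) := by
      rw [hU]
      simp only [Set.iUnion_subset_iff, Finset.mem_range]
      intro i hi
      split_ifs
      · exact Set.Icc_subset_Icc (extCuts_mem hc i).1 (hmono hi)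
      · simp
    have hU1 : IntegrableOn v U := (dens_integrable hv).mono_set
      (hUs.trans (Set.Icc_subset_Icc le_rfl (extCuts_mem hc n).2))
    rw [← ih]
    split_ifs with h
    · have hI : IntegrableOn v (Set.Icc (extCuts k c n) (extCuts k c (n + 1))) :=
        (dens_integrable hv).mono_set
          (Set.Icc_subset_Icc (extCuts_mem hc n).1 (extCuts_mem hc (n+1)).2)
      rw [setIntegral_union₀ _ measurableSet_Icc.nullMeasurableSet hU1 hI,
        cumF_sub hv (extCuts_mem hc n) (extCuts_mem hc (n+1)),
        intervalIntegral.integral_of_le (hmono (Nat.le_succ n)), ← integral_Icc_eq_integral_Ioc]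
      refine measure_mono_null (t := {extCuts k c n}) ?_ (by simp)
      rintro x ⟨h1, h2⟩
      exact le_antisymm (hUs h1).2 h2.1
    · simp

lemma val_add (k : ℕ) (G : ℝ → ℝ) (c : Fin k → ℝ) (b : Bool) :
    val k G c b + val k G c (!b) = G 1 - G 0 := by
  unfold val
  rw [← Finset.sum_add_distrib]
  have : ∀ i ∈ Finset.range (k+1),
      ((if decide (i % 2 = 0) = b then G (extCuts k c (i + 1)) - G (extCuts k c i) else 0) +
      if decide (i % 2 = 0) = !b then G (extCuts k c (i + 1)) - G (extCuts k c i) else 0)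
      = G (extCuts k c (i + 1)) - G (extCuts k c i) := by
    intro i _
    cases b <;> by_cases h : i % 2 = 0 <;> simp [h]
  rw [Finset.sum_congr rfl this, Finset.sum_range_sub (fun i => G (extCuts k c i)),
    extCuts_zero, extCuts_last k c _ le_rfl]

lemma val_nonneg {δ Δ : ℝ} (hδ : 0 < δ) {v : ℝ → ℝ} (hv : IsValueDensity δ Δ v) {k : ℕ}
    {c : Fin k → ℝ} (hc : ValidCuts k c) (b : Bool) : 0 ≤ val k (cumF v) c b := by
  unfold val
  refine Finset.sum_nonneg fun i _ => ?_
  split_ifs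
  · have h := extCuts_mono hc (Nat.le_succ i)
    have := cumF_lower hv (extCuts_mem hc i).1 h (extCuts_mem hc (i+1)).2
    have h2 : 0 ≤ δ * (extCuts k c (i+1) - extCuts k c i) := mul_nonneg hδ.le (sub_nonneg.2 h)
    exact le_trans h2 this
  · exact le_rfl

lemma val_compl {δ Δ : ℝ} {v : ℝ → ℝ} (hv : IsValueDensity δ Δ v) {k : ℕ}
    (c : Fin k → ℝ) (b : Bool) : val k (cumF v) c (!b) = 1 - val k (cumF v) c b := by
  have := val_add k (cumF v) c b
  rw [cumF_one hv, cumF_zero] at this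
  linarith

lemma val_le_one {δ Δ : ℝ} (hδ : 0 < δ) {v : ℝ → ℝ} (hv : IsValueDensity δ Δ v) {k : ℕ}
    {c : Fin k → ℝ} (hc : ValidCuts k c) (b : Bool) : val k (cumF v) c b ≤ 1 := by
  have := val_nonneg hδ hv hc (!b)
  rw [val_compl hv] at this
  linarith

lemma val_approx {k : ℕ} {G H : ℝ → ℝ} {E : ℝ} (hGH : ∀ x ∈ Set.Icc (0:ℝ) 1, |G x - H x| ≤ E)
    {c : Fin k → ℝ} (hc : ValidCuts k c) (b : Bool) :
    |val k G c b - val k H c b| ≤ (k + 1) * (2 * E) := by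
  unfold val
  rw [← Finset.sum_sub_distrib]
  refine (Finset.abs_sum_le_sum_abs _ _).trans ?_
  have hE : 0 ≤ E := le_trans (abs_nonneg _) (hGH 0 (by simp))
  have : ∀ i ∈ Finset.range (k+1), |(if decide (i % 2 = 0) = b then
      G (extCuts k c (i + 1)) - G (extCuts k c i) else 0) - (if decide (i % 2 = 0) = b then
      H (extCuts k c (i + 1)) - H (extCuts k c i) else 0)| ≤ 2 * E := by
    intro i _
    split_ifs
    · have h1 := abs_le.1 (hGH _ (extCuts_mem hc i))
      have h2 := abs_le.1 (hGH _ (extCuts_mem hc (i+1)))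
      exact abs_le.2 ⟨by linarith, by linarith⟩
    · simp [hE]
  refine (Finset.sum_le_sum this).trans ?_
  simp

/-- Moving the right endpoint of a `b`-interval. -/
lemma val_update_right {k : ℕ} (G : ℝ → ℝ) (c : Fin k → ℝ) (b : Bool) (i : ℕ) (hi : i < k)
    (hb : decide (i % 2 = 0) = b) (y : ℝ) :
    val k G (Function.update c ⟨i, hi⟩ y) b = val k G c b + (G y - G (extCuts k c (i + 1))) := by
  have hext : ∀ n, extCuts k (Function.update c ⟨i, hi⟩ y) n =
      if n = i + 1 then y else extCuts k c n := by
    intro n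
    unfold extCuts
    rcases n with _ | n
    · simp
    · by_cases hn : n < k
      · simp [hn, Function.update_apply]
      · simp [hn]; omega
  have h1 : G y - G (extCuts k c (i + 1)) =
      ∑ n ∈ Finset.range (k+1), if n = i then G y - G (extCuts k c (i + 1)) else 0 := by
    rw [Finset.sum_ite_eq', if_pos (Finset.mem_range.2 (by omega))]
  rw [h1]
  unfold val
  rw [← Finset.sum_add_distrib]
  refine Finset.sum_congr rfl fun n _ => ?_
  rw [hext, hext]
  subst hb
  by_cases hni : n = i
  · subst hni; simp
  · by_cases hn2 : n = i + 1
    · subst hn2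
      have : ¬ (decide ((i+1) % 2 = 0) = decide (i % 2 = 0)) := by
        by_cases h : i % 2 = 0
        · have : ¬ ((i+1) % 2 = 0) := by omega
          simp [h, this]
        · have : ((i+1) % 2 = 0) := by omega
          simp [h, this]
      rw [if_neg this, if_neg this]; simp
    · simp [hni, hn2]

/-- Moving the left endpoint of the last interval. -/
lemma val_update_left {k : ℕ} (G : ℝ → ℝ) (c : Fin k → ℝ) (b : Bool) (i : ℕ) (hi : i + 1 = k)
    (hb : decide (k % 2 = 0) = b) (y : ℝ) :
    val k G (Function.update c ⟨i, by omega⟩ y) b = val k G c b + (G (extCuts k c k) - G y) := by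
  have hext : ∀ n, extCuts k (Function.update c ⟨i, by omega⟩ y) n =
      if n = k then y else extCuts k c n := by
    intro n
    unfold extCuts
    rcases n with _ | n
    · simp; omega
    · by_cases hn : n < k
      · have : (n + 1 = k) ↔ n = i := by omega
        simp [hn, Function.update_apply, this]
      · simp [hn]; omega
  have h1 : G (extCuts k c k) - G y =
      ∑ n ∈ Finset.range (k+1), if n = k then G (extCuts k c k) - G y else 0 := by
    rw [Finset.sum_ite_eq', if_pos (Finset.mem_range.2 (by omega))]
  rw [h1]
  unfold val
  rw [← Finset.sum_add_distrib]
  refine Finset.sum_congr rfl fun n _ => ?_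
  rw [hext, hext]
  subst hb
  by_cases hni : n = k
  · subst hni; simp
  · by_cases hn2 : n + 1 = k
    · have : ¬ (decide (n % 2 = 0) = decide (k % 2 = 0)) := by
        by_cases h : n % 2 = 0
        · have : ¬ (k % 2 = 0) := by omega
          simp [h, this]
        · have : (k % 2 = 0) := by omega
          simp [h, this]
      rw [if_neg this, if_neg this]; simp [hni]
    · simp [hni, hn2]


/-! ### Part 2: giving Bob a margin -/

lemma valid_update {k : ℕ} {c : Fin k → ℝ} (hc : ValidCuts k c) (i : ℕ) (hi : i < k) (y : ℝ)
    (h1 : extCuts k c i ≤ y) (h2 : y ≤ extCuts k c (i + 2)) :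
    ValidCuts k (Function.update c ⟨i, hi⟩ y) := by
  have hm := extCuts_mono hc
  constructor
  · intro a b hab
    by_cases ha : a = ⟨i, hi⟩
    · by_cases hb : b = ⟨i, hi⟩
      · rw [ha, hb]
      · rw [ha, Function.update_self, Function.update_of_ne hb]
        have hlt : i < b.1 := by
          rw [ha] at hab
          have h3 : i ≤ b.1 := hab
          have h4 : b.1 ≠ i := fun h => hb (Fin.ext h)
          omega
        refine h2.trans ((hm (show i + 2 ≤ b.1 + 1 by omega)).trans ?_)
        rw [extCuts_succ k c b.1 b.2]
    · by_cases hb : b = ⟨i, hi⟩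
      · rw [hb, Function.update_self, Function.update_of_ne ha]
        have hlt : a.1 < i := by
          rw [hb] at hab
          have h3 : a.1 ≤ i := hab
          have h4 : a.1 ≠ i := fun h => ha (Fin.ext h)
          omega
        refine le_trans (le_trans ?_ (hm (show a.1 + 1 ≤ i by omega))) h1
        rw [extCuts_succ k c a.1 a.2]
      · rw [Function.update_of_ne ha, Function.update_of_ne hb]; exact hc.1 hab
  · intro a
    by_cases ha : a = ⟨i, hi⟩
    · rw [ha, Function.update_self]
      exact ⟨(extCuts_mem hc i).1.trans h1, h2.trans (extCuts_mem hc _).2⟩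
    · rw [Function.update_of_ne ha]; exact hc.2 a

lemma shrink {δ Δ : ℝ} (hδ : 0 < δ) (hδΔ : δ ≤ Δ) {vA vB : ℝ → ℝ} (hA : IsValueDensity δ Δ vA)
    (hB : IsValueDensity δ Δ vB) {k : ℕ} (hk : 1 ≤ k) {c : Fin k → ℝ} (hc : ValidCuts k c)
    (b : Bool) {μ : ℝ} (hμ : 0 < μ) (hμ1 : 2 * μ ≤ 1 / 4)
    (hμ2 : Δ * (2 * μ / δ) * (k + 1) ≤ 1 / 4)
    (hf : 1 / 2 ≤ val k (cumF vB) c (!b)) :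
    ∃ c' : Fin k → ℝ, ValidCuts k c' ∧ 1 / 2 + 2 * μ ≤ val k (cumF vB) c' (!b) ∧
      val k (cumF vA) c b - Δ * (2 * μ / δ) ≤ val k (cumF vA) c' b := by
  have hΔ : 0 < Δ := hδ.trans_le hδΔ
  set τ := 2 * μ / δ with hτ
  have hτ0 : 0 < τ := by positivity
  have hδτ : δ * τ = 2 * μ := by rw [hτ]; field_simp
  by_cases h0 : val k (cumF vB) c b ≤ 1 / 2 - 2 * μ
  · refine ⟨c, hc, ?_, ?_⟩
    · rw [val_compl hB]; linarith
    · have : 0 < Δ * τ := by positivity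
      linarith
  push Not at h0
  have hm := extCuts_mono hc
  -- a long interval
  obtain ⟨i, hik, hib, hlen⟩ : ∃ i, i < k + 1 ∧ decide (i % 2 = 0) = b ∧
      τ ≤ extCuts k c (i+1) - extCuts k c i := by
    by_contra hcon
    push Not at hcon
    have : val k (cumF vB) c b ≤ ∑ i ∈ Finset.range (k+1), Δ * τ := by
      unfold val
      refine Finset.sum_le_sum fun i hi => ?_
      split_ifs with h
      · have h1 := hcon i (Finset.mem_range.1 hi) h
        have h2 := cumF_upper hB (extCuts_mem hc i).1 (hm (Nat.le_succ i)) (extCuts_mem hc (i+1)).2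
        have h3 := mul_le_mul_of_nonneg_left h1.le hΔ.le
        exact h2.trans h3
      · positivity
    rw [Finset.sum_const, Finset.card_range, nsmul_eq_mul] at this
    push_cast at this
    linarith
  have e0 := (extCuts_mem hc i).1
  have e1 := (extCuts_mem hc (i+1)).2
  by_cases hik' : i < k
  · refine ⟨Function.update c ⟨i, hik'⟩ (extCuts k c (i+1) - τ), ?_, ?_, ?_⟩
    · apply valid_update hc
      · linarith
      · have := hm (show i + 1 ≤ i + 2 by omega)
        linarith
    · rw [val_compl hB, val_update_right _ _ _ _ _ hib]
      rw [val_compl hB] at hf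
      have := cumF_lower hB (x := extCuts k c (i+1) - τ) (y := extCuts k c (i+1)) (by linarith)
        (by linarith) e1
      rw [sub_sub_cancel, hδτ] at this
      linarith
    · rw [val_update_right _ _ _ _ _ hib]
      have := cumF_upper hA (x := extCuts k c (i+1) - τ) (y := extCuts k c (i+1)) (by linarith)
        (by linarith) e1
      rw [sub_sub_cancel] at this
      linarith
  · have hik2 : i = k := by omega
    subst hik2
    obtain ⟨j, hj⟩ : ∃ j, j + 1 = i := ⟨i - 1, by omega⟩
    refine ⟨Function.update c ⟨j, by omega⟩ (extCuts i c i + τ), ?_, ?_, ?_⟩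
    · apply valid_update hc
      · have := hm (show j ≤ i by omega)
        linarith
      · rw [show j + 2 = i + 1 by omega]
        linarith
    · rw [val_compl hB, val_update_left _ _ _ _ hj hib]
      rw [val_compl hB] at hf
      have := cumF_lower hB (x := extCuts i c i) (y := extCuts i c i + τ) (by linarith)
        (by linarith) (by linarith)
      rw [add_sub_cancel_left, hδτ] at this
      linarith
    · rw [val_update_left _ _ _ _ hj hib]
      have := cumF_upper hA (x := extCuts i c i) (y := extCuts i c i + τ) (by linarith)
        (by linarith) (by linarith)
      rw [add_sub_cancel_left] at this
      linarith

/-! ### Part 3: three-cut queries -/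

/-- clamp to `[0,1]` -/
def clamp (x : ℝ) : ℝ := max 0 (min x 1)

lemma clamp_mem (x : ℝ) : clamp x ∈ Set.Icc (0:ℝ) 1 :=
  ⟨le_max_left _ _, max_le zero_le_one (min_le_right _ _)⟩

lemma clamp_eq {x : ℝ} (h : x ∈ Set.Icc (0:ℝ) 1) : clamp x = x := by
  unfold clamp; rw [min_eq_left h.2, max_eq_right h.1]

/-- Valid cut vectors. -/
abbrev Cut (k : ℕ) := {c : Fin k → ℝ // ValidCuts k c}

/-- Cuts at (sanitized) `x, y, z`, the remaining cuts at `1`. -/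
def cut3 (k : ℕ) (x y z : ℝ) : Cut k :=
  ⟨fun i => if i.1 = 0 then clamp x else if i.1 = 1 then max (clamp x) (clamp y)
    else if i.1 = 2 then max (max (clamp x) (clamp y)) (clamp z) else 1, by
    have hx := clamp_mem x
    have hy := clamp_mem y
    have hz := clamp_mem z
    constructor
    · intro a b hab
      have hab' : a.1 ≤ b.1 := hab
      have h1 : max (clamp x) (clamp y) ≤ 1 := max_le hx.2 hy.2
      have h2 : max (max (clamp x) (clamp y)) (clamp z) ≤ 1 := max_le h1 hz.2
      have h3 := le_max_left (clamp x) (clamp y)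
      have h4 := le_max_left (max (clamp x) (clamp y)) (clamp z)
      have h5 := h3.trans h4
      have h6 := hx.2
      dsimp only
      split_ifs <;> first | omega | exact le_rfl | assumption
    · intro a
      dsimp only
      have h1 : max (clamp x) (clamp y) ≤ 1 := max_le hx.2 hy.2
      have h3 := le_max_left (clamp x) (clamp y)
      split_ifs
      · exact hx
      · exact ⟨hx.1.trans h3, h1⟩
      · exact ⟨hz.1.trans (le_max_right _ _), max_le h1 hz.2⟩
      · simp⟩

lemma val_cut3 {k : ℕ} (hk : 3 ≤ k) (G : ℝ → ℝ) {x y z : ℝ} (hx : 0 ≤ x) (hxy : x ≤ y)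
    (hyz : y ≤ z) (hz : z ≤ 1) :
    val k G (cut3 k x y z).1 false = (G y - G x) + (G 1 - G z) := by
  have cx : clamp x = x := clamp_eq ⟨hx, by linarith⟩
  have cy : clamp y = y := clamp_eq ⟨by linarith, by linarith⟩
  have cz : clamp z = z := clamp_eq ⟨by linarith, by linarith⟩
  have e1 : extCuts k (cut3 k x y z).1 1 = x := by
    rw [extCuts_succ k _ 0 (by omega)]; simp [cut3, cx]
  have e2 : extCuts k (cut3 k x y z).1 2 = y := by
    rw [extCuts_succ k _ 1 (by omega)]; simp [cut3, cx, cy, hxy]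
  have e3 : extCuts k (cut3 k x y z).1 3 = z := by
    rw [extCuts_succ k _ 2 (by omega)]; simp [cut3, cx, cy, cz, hxy, hyz]
  have e4 : ∀ n, 4 ≤ n → extCuts k (cut3 k x y z).1 n = 1 := by
    intro n hn
    by_cases h : n ≤ k
    · obtain ⟨m, rfl⟩ : ∃ m, n = m + 1 := ⟨n - 1, by omega⟩
      rw [extCuts_succ k _ m (by omega)]
      have a0 : m ≠ 0 := by omega
      have a1 : m ≠ 1 := by omega
      have a2 : m ≠ 2 := by omega
      simp [cut3, a0, a1, a2]
    · exact extCuts_last _ _ _ (by omega)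
  unfold val
  rw [← Finset.sum_subset (s₁ := Finset.range 4)]
  · rw [Finset.sum_range_succ, Finset.sum_range_succ, Finset.sum_range_succ, Finset.sum_range_succ,
      Finset.sum_range_zero]
    simp [e1, e2, e3, e4 4 le_rfl]
  · intro a ha
    rw [Finset.mem_range] at *
    omega
  · intro a _ ha
    rw [Finset.mem_range] at ha
    rw [e4 a (by omega), e4 (a+1) (by omega)]
    simp


/-! ### Part 4: query programs -/

/-- Decision trees asking cut vectors. -/
inductive Prog (k : ℕ) (β : Type) : Type
  | done (r : β) : Prog k β
  | ask (c : Cut k) (f : Bool → Prog k β) : Prog k β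

namespace Prog

variable {k : ℕ} {β γ : Type}

/-- Sequencing. -/
def bind : Prog k β → (β → Prog k γ) → Prog k γ
  | done r, g => g r
  | ask c f, g => ask c (fun a => bind (f a) g)

/-- All executions with total loss at most `B` finish within `n` questions with a result
satisfying `P`. -/
def Sat (l : Cut k → Bool → ℝ) (P : β → Prop) : Prog k β → ℕ → ℝ → Prop
  | done r, _, _ => P r
  | ask _ _, 0, _ => False
  | ask c f, n + 1, B => ∀ a, l c a ≤ B → Sat l P (f a) n (B - l c a)

lemma Sat.mono {l : Cut k → Bool → ℝ} {P Q : β → Prop} (hPQ : ∀ r, P r → Q r) (p : Prog k β) :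
    ∀ {n n' : ℕ} {B B' : ℝ}, n ≤ n' → B' ≤ B → Sat l P p n B → Sat l Q p n' B' := by
  induction p with
  | done r => intro n n' B B' _ _ h; exact hPQ r h
  | ask c f ih =>
    intro n n' B B' hn hB h
    cases n with
    | zero => exact h.elim
    | succ n =>
      cases n' with
      | zero => omega
      | succ n' =>
        intro a ha
        exact ih a (Nat.succ_le_succ_iff.1 hn) (by linarith) (h a (ha.trans hB))

lemma Sat.bind {l : Cut k → Bool → ℝ} (hl : ∀ c a, 0 ≤ l c a) {P : β → Prop} {Q : γ → Prop}
    {g : β → Prog k γ} {n' : ℕ} {B : ℝ} (hg : ∀ r, P r → Sat l Q (g r) n' B) (p : Prog k β) :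
    ∀ {n : ℕ} {B' : ℝ}, B' ≤ B → Sat l P p n B' → Sat l Q (p.bind g) (n + n') B' := by
  induction p with
  | done r =>
    intro n B' hB h
    exact Sat.mono (fun _ h => h) _ (by omega) hB (hg r h)
  | ask c f ih =>
    intro n B' hB h
    cases n with
    | zero => exact h.elim
    | succ n =>
      rw [show n + 1 + n' = (n + n') + 1 by omega]
      intro a ha
      exact ih a (by linarith [hl c a]) (h a ha)

/-- Repeat a question until one of the answers has been given often enough. -/
def rep (c : Cut k) : ℕ → ℕ → Prog k Bool
  | 0, _ => done true
  | _ + 1, 0 => done false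
  | i + 1, j + 1 => ask c (fun a => if a then rep c i (j + 1) else rep c (i + 1) j)
termination_by i j => i + j

lemma sat_rep (l : Cut k → Bool → ℝ) (c : Cut k) (hl : ∀ a, 0 ≤ l c a) (M : ℕ) (B : ℝ) :
    ∀ (s i j : ℕ) (B' : ℝ), i + j = s → i ≤ M → j ≤ M → 0 ≤ B' →
      ((M:ℝ) - i) * l c true + ((M:ℝ) - j) * l c false + B' ≤ B →
      Sat l (fun b => (M:ℝ) * l c b ≤ B) (rep c i j) s B' := by
  intro s
  induction s with
  | zero =>
    intro i j B' hs hi hj hB h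
    have : i = 0 := by omega
    have : j = 0 := by omega
    subst i; subst j
    rw [rep]
    show (M:ℝ) * l c true ≤ B
    have := mul_nonneg (Nat.cast_nonneg (α := ℝ) M) (hl false)
    simp only [Nat.cast_zero, sub_zero] at h
    linarith
  | succ s ih =>
    intro i j B' hs hi hj hB h
    have hi' : (0:ℝ) ≤ (M:ℝ) - i := sub_nonneg.2 (by exact_mod_cast hi)
    have hj' : (0:ℝ) ≤ (M:ℝ) - j := sub_nonneg.2 (by exact_mod_cast hj)
    have m1 := mul_nonneg hi' (hl true)
    have m2 := mul_nonneg hj' (hl false)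
    cases i with
    | zero =>
      rw [rep]
      show (M:ℝ) * l c true ≤ B
      simp only [Nat.cast_zero, sub_zero] at h
      linarith
    | succ i =>
      cases j with
      | zero =>
        rw [rep]
        show (M:ℝ) * l c false ≤ B
        simp only [Nat.cast_zero, sub_zero] at h
        linarith
      | succ j =>
        rw [rep]
        push_cast at h
        intro a ha
        cases a
        · simp only [Bool.false_eq_true, if_false]
          refine ih (i+1) j _ (by omega) hi (by omega) (by linarith) ?_
          push_cast
          linarith
        · simp only [if_true]
          refine ih i (j+1) _ (by omega) (by omega) hj (by linarith) ?_
          push_cast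
          linarith

lemma sat_query (l : Cut k → Bool → ℝ) (c : Cut k) (hl : ∀ a, 0 ≤ l c a) (M : ℕ) {B : ℝ}
    (hB : 0 ≤ B) : Sat l (fun b => (M:ℝ) * l c b ≤ B) (rep c M M) (M + M) B :=
  sat_rep l c hl M B (M + M) M M B rfl le_rfl le_rfl hB (by simp)

/-- Bisection. -/
def bis (M : ℕ) (q : ℝ → Cut k) : ℕ → ℝ → ℝ → Prog k ℝ
  | 0, lo, _ => done lo
  | n + 1, lo, hi => (rep (q ((lo + hi) / 2)) M M).bind
      (fun b => if b then bis M q n ((lo + hi) / 2) hi else bis M q n lo ((lo + hi) / 2))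

lemma sat_bis {l : Cut k → Bool → ℝ} (hl : ∀ c a, 0 ≤ l c a) {M : ℕ} {B : ℝ} (hB : 0 ≤ B)
    {q : ℝ → Cut k} {H : ℝ → ℝ} {κ D lo₀ hi₀ : ℝ}
    (hLip : ∀ x y, lo₀ ≤ x → x ≤ y → y ≤ hi₀ → H y - H x ≤ D * (y - x))
    (htrue : ∀ x, lo₀ ≤ x → x ≤ hi₀ → (M:ℝ) * l (q x) true ≤ B → H x ≤ 1 / 2 + κ)
    (hfalse : ∀ x, lo₀ ≤ x → x ≤ hi₀ → (M:ℝ) * l (q x) false ≤ B → 1 / 2 - κ ≤ H x) :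
    ∀ (n : ℕ) (lo hi : ℝ), lo₀ ≤ lo → lo ≤ hi → hi ≤ hi₀ → H lo ≤ 1 / 2 + κ → 1 / 2 - κ ≤ H hi →
      Sat l (fun y => lo ≤ y ∧ y ≤ hi ∧ H y ≤ 1 / 2 + κ ∧
        1 / 2 - κ - D * ((hi - lo) / 2 ^ n) ≤ H y) (bis M q n lo hi) (n * (M + M)) B := by
  intro n
  induction n with
  | zero =>
    intro lo hi h1 h2 h3 h4 h5
    refine ⟨le_rfl, h2, h4, ?_⟩
    have := hLip lo hi h1 h2 h3
    simp only [pow_zero, div_one]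
    linarith
  | succ n ih =>
    intro lo hi h1 h2 h3 h4 h5
    rw [bis, show (n + 1) * (M + M) = (M + M) + n * (M + M) by ring]
    refine Sat.bind hl (P := fun b => (M:ℝ) * l (q ((lo + hi) / 2)) b ≤ B) ?_ _ le_rfl
      (sat_query l _ (hl _) M hB)
    intro b hb
    have a1 : lo ≤ (lo + hi) / 2 := by linarith
    have a2 : (lo + hi) / 2 ≤ hi := by linarith
    have p2 : (2:ℝ) ^ (n + 1) ≠ 0 := by positivity
    have p1 : (2:ℝ) ^ n ≠ 0 := by positivity
    cases b
    · simp only [Bool.false_eq_true, if_false]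
      refine Sat.mono ?_ _ le_rfl le_rfl (ih lo ((lo + hi) / 2) h1 a1 (a2.trans h3) h4
        (hfalse _ (h1.trans a1) (a2.trans h3) hb))
      rintro y ⟨b1, b2, b3, b4⟩
      refine ⟨b1, b2.trans a2, b3, ?_⟩
      have : ((lo + hi) / 2 - lo) / 2 ^ n = (hi - lo) / 2 ^ (n+1) := by
        field_simp; ring
      rw [← this]; exact b4
    · simp only [if_true]
      refine Sat.mono ?_ _ le_rfl le_rfl (ih ((lo + hi) / 2) hi (h1.trans a1) a2 h3
        (htrue _ (h1.trans a1) (a2.trans h3) hb) h5)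
      rintro y ⟨b1, b2, b3, b4⟩
      refine ⟨a1.trans b1, b2, b3, ?_⟩
      have : (hi - (lo + hi) / 2) / 2 ^ n = (hi - lo) / 2 ^ (n+1) := by
        field_simp; ring
      rw [← this]; exact b4

/-- Residual program after one answer. -/
def step : Prog k β → Bool → Prog k β
  | done r, _ => done r
  | ask _ f, a => f a

/-- Current cut vector. -/
def head (g : β → Cut k) : Prog k β → Cut k
  | done r => g r
  | ask c _ => c

/-- Residual program after a history. -/
def resid (p : Prog k β) (h : Hist k) : Prog k β := (h.map Prod.snd).foldl step p

lemma resid_append (p : Prog k β) (h : Hist k) (c : Fin k → ℝ) (a : Bool) :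
    resid p (h ++ [(c, a)]) = step (resid p h) a := by
  simp [resid]

lemma sat_run {l : Cut k → Bool → ℝ} (hl : ∀ c a, 0 ≤ l c a) (g : β → Cut k) {P : β → Prop}
    {n : ℕ} {B : ℝ} (p : ℕ → Prog k β)
    (a : ℕ → Bool) (hp : ∀ t, p (t + 1) = step (p t) (a t)) (h0 : Sat l P (p 0) n B) (T : ℕ)
    (hB : ∑ s ∈ Finset.range T, l (head g (p s)) (a s) ≤ B) :
    ∀ t, t ≤ T → (∃ r, p t = done r ∧ P r) ∨
      (t ≤ n ∧ Sat l P (p t) (n - t) (B - ∑ s ∈ Finset.range t, l (head g (p s)) (a s))) := by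
  intro t
  induction t with
  | zero => intro _; right; simpa using h0
  | succ t ih =>
    intro ht
    rcases ih (by omega) with ⟨r, hr, hP⟩ | ⟨htn, hS⟩
    · left; exact ⟨r, by rw [hp, hr]; rfl, hP⟩
    · have hle : ∑ s ∈ Finset.range (t+1), l (head g (p s)) (a s) ≤ B := by
        refine le_trans (Finset.sum_le_sum_of_subset_of_nonneg ?_ fun _ _ _ => hl _ _) hB
        intro x hx
        rw [Finset.mem_range] at *
        omega
      rw [Finset.sum_range_succ] at hle ⊢
      rw [hp]
      cases hpt : p t with
      | done r =>
        rw [hpt] at hS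
        left; exact ⟨r, rfl, hS⟩
      | ask c f =>
        rw [hpt] at hS hle
        right
        obtain ⟨m, hm⟩ | hm : (∃ m, n - t = m + 1) ∨ n - t = 0 := by
          rcases h : n - t with _ | m
          · right; rfl
          · left; exact ⟨m, rfl⟩
        · rw [hm] at hS
          refine ⟨by omega, ?_⟩
          rw [show n - (t+1) = m by omega]
          have hh : head g (ask c f) = c := rfl
          rw [hh] at hle ⊢
          have := hS (a t) (by linarith)
          rw [← sub_sub]
          exact this
        · rw [hm] at hS; exact hS.elim

lemma sat_run_done {l : Cut k → Bool → ℝ} (hl : ∀ c a, 0 ≤ l c a) (g : β → Cut k) {P : β → Prop}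
    {n : ℕ} {B : ℝ} (p : ℕ → Prog k β)
    (a : ℕ → Bool) (hp : ∀ t, p (t + 1) = step (p t) (a t)) (h0 : Sat l P (p 0) n B) (T : ℕ)
    (hB : ∑ s ∈ Finset.range T, l (head g (p s)) (a s) ≤ B) (t : ℕ) (ht : t < T) (hn : n ≤ t) :
    ∃ r, p t = done r ∧ P r := by
  rcases sat_run hl g p a hp h0 T hB t ht.le with h | ⟨htn, hS⟩
  · exact h
  · rw [show n - t = 0 by omega] at hS
    cases hpt : p t with
    | done r => rw [hpt] at hS; exact ⟨r, rfl, hS⟩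
    | ask c f => rw [hpt] at hS; exact hS.elim

end Prog


/-! ### Part 5: the learning program -/

/-- Bob's one-round regret. -/
def lossB (k : ℕ) (vB : ℝ → ℝ) (c : Cut k) (b : Bool) : ℝ :=
  max (val k (cumF vB) c.1 true) (val k (cumF vB) c.1 false) - val k (cumF vB) c.1 b

lemma lossB_nonneg (k : ℕ) (vB : ℝ → ℝ) (c : Cut k) (b : Bool) : 0 ≤ lossB k vB c b := by
  unfold lossB
  cases b
  · linarith [le_max_right (val k (cumF vB) c.1 true) (val k (cumF vB) c.1 false)]
  · linarith [le_max_left (val k (cumF vB) c.1 true) (val k (cumF vB) c.1 false)]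

lemma lossB_true {δ Δ : ℝ} {vB : ℝ → ℝ} (hB : IsValueDensity δ Δ vB) {k M : ℕ} (hM : 1 ≤ M)
    {B ε : ℝ} (hε : B ≤ 2 * M * ε) (c : Cut k) (h : (M:ℝ) * lossB k vB c true ≤ B) :
    val k (cumF vB) c.1 false ≤ 1 / 2 + ε := by
  have hM' : (0:ℝ) < M := by exact_mod_cast hM
  have h1 : (M:ℝ) * lossB k vB c true ≤ M * (2 * ε) := by linarith
  have h2 := le_of_mul_le_mul_left h1 hM'
  unfold lossB at h2
  have h3 := le_max_right (val k (cumF vB) c.1 true) (val k (cumF vB) c.1 false)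
  have h4 := val_compl hB c.1 false
  simp only [Bool.not_false] at h4
  linarith

lemma lossB_false {δ Δ : ℝ} {vB : ℝ → ℝ} (hB : IsValueDensity δ Δ vB) {k M : ℕ} (hM : 1 ≤ M)
    {B ε : ℝ} (hε : B ≤ 2 * M * ε) (c : Cut k) (h : (M:ℝ) * lossB k vB c false ≤ B) :
    1 / 2 - ε ≤ val k (cumF vB) c.1 false := by
  have hM' : (0:ℝ) < M := by exact_mod_cast hM
  have h1 : (M:ℝ) * lossB k vB c false ≤ M * (2 * ε) := by linarith
  have h2 := le_of_mul_le_mul_left h1 hM'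
  unfold lossB at h2
  have h3 := le_max_left (val k (cumF vB) c.1 true) (val k (cumF vB) c.1 false)
  have h4 := val_compl hB c.1 false
  simp only [Bool.not_false] at h4
  linarith

open Prog

/-- Find `z` with `F z ≈ F x + 1/2`. -/
def opp (k M L : ℕ) (x : ℝ) : Prog k ℝ := bis M (fun z => cut3 k x z 1) L x 1

/-- Find `y` with `F y - F p ≈ F r - 1/2`. -/
def adv (k M L : ℕ) (r p : ℝ) : Prog k ℝ := bis M (fun y => cut3 k p y r) L p r

/-- Walk from `p` past `m` with equal steps. -/
def chain (k M L : ℕ) (m r : ℝ) : ℕ → ℕ → ℝ → (ℕ → ℝ × ℝ) → Prog k (ℕ × (ℕ → ℝ × ℝ))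
  | 0, j, _, acc => done (j, acc)
  | f + 1, j, p, acc =>
    if m < p then done (j, acc) else
      (opp k M L p).bind fun z => (adv k M L r p).bind fun y =>
        chain k M L m r f (j + 1) y (Function.update acc j (p, z))

/-- The exploration phase. -/
def learn (k M L fuel : ℕ) (η : ℝ) : Prog k (ℕ × (ℕ → ℝ × ℝ)) :=
  (opp k M L 0).bind fun m => (opp k M L η).bind fun r =>
    chain k M L m r fuel 0 0 (fun _ => (0, 0))

/-- Quality of the `i`-th recorded pair. -/
def GoodPt (F : ℝ → ℝ) (w e : ℝ) (i : ℕ) (q : ℝ × ℝ) : Prop :=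
  q.1 ∈ Set.Icc (0:ℝ) 1 ∧ q.2 ∈ Set.Icc (0:ℝ) 1 ∧ |F q.1 - i * w| ≤ 3 * i * e ∧
    F q.1 ≤ 1 / 2 + e ∧ |F q.2 - F q.1 - 1 / 2| ≤ 2 * e

/-- Quality of the exploration result. -/
def GoodRes (F : ℝ → ℝ) (w e : ℝ) (fuel : ℕ) (res : ℕ × (ℕ → ℝ × ℝ)) : Prop :=
  res.1 ≤ fuel ∧ 1 / 2 - e - 3 * res.1 * e ≤ res.1 * w ∧ ∀ i < res.1, GoodPt F w e i (res.2 i)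

lemma sat_opp {δ Δ : ℝ} (hδ : 0 < δ) (hδΔ : δ ≤ Δ) {vB : ℝ → ℝ} (hB : IsValueDensity δ Δ vB)
  {k M L : ℕ} (hk : 3 ≤ k) (hM : 1 ≤ M) {B ε e : ℝ} (hB0 : 0 ≤ B) (hε : B ≤ 2 * M * ε)
  (hε0 : 0 ≤ ε) (he : ε + Δ / 2 ^ L ≤ e)
    {κ x : ℝ} (hκ : ε ≤ κ) (hx0 : 0 ≤ x) (hx1 : x ≤ 1) (hx : cumF vB x ≤ 1 / 2 + κ) :
    Sat (lossB k vB) (fun z => x ≤ z ∧ z ≤ 1 ∧ |cumF vB z - cumF vB x - 1 / 2| ≤ κ + (e - ε))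
      (opp k M L x) (L * (M + M)) B := by
  have hΔ : 0 < Δ := hδ.trans_le hδΔ
  have hval : ∀ z, x ≤ z → z ≤ 1 → val k (cumF vB) (cut3 k x z 1).1 false
      = cumF vB z - cumF vB x := by
    intro z h1 h2
    rw [val_cut3 hk _ hx0 h1 h2 le_rfl]; ring
  refine Sat.mono ?_ _ le_rfl le_rfl (sat_bis (lossB_nonneg k vB) hB0
    (H := fun z => val k (cumF vB) (cut3 k x z 1).1 false) (κ := κ) (D := Δ) (lo₀ := x) (hi₀ := 1)
    ?_ ?_ ?_ L x 1 le_rfl hx1 le_rfl ?_ ?_)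
  · rintro z ⟨h1, h2, h3, h4⟩
    refine ⟨h1, h2, ?_⟩
    simp only [hval z h1 h2] at h3 h4
    have h5 : Δ * ((1 - x) / 2 ^ L) ≤ Δ / 2 ^ L := by
      rw [← mul_div_assoc]
      refine div_le_div_of_nonneg_right ?_ (by positivity)
      nlinarith
    have h6 : 0 ≤ Δ / 2 ^ L := by positivity
    rw [abs_le]
    constructor <;> linarith
  · intro a b h1 h2 h3
    rw [hval b (by linarith) (by linarith), hval a (by linarith) (by linarith)]
    have := cumF_upper hB (by linarith) h2 (by linarith)
    linarith
  · intro y h1 h2 h3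
    exact (lossB_true hB hM hε _ h3).trans (by linarith)
  · intro y h1 h2 h3
    exact le_trans (by linarith) (lossB_false hB hM hε _ h3)
  · rw [hval x le_rfl hx1]; linarith
  · rw [hval 1 hx1 le_rfl, cumF_one hB]; linarith

lemma sat_adv {δ Δ : ℝ} (hδ : 0 < δ) (hδΔ : δ ≤ Δ) {vB : ℝ → ℝ} (hB : IsValueDensity δ Δ vB)
  {k M L : ℕ} (hk : 3 ≤ k) (hM : 1 ≤ M) {B ε e : ℝ} (hB0 : 0 ≤ B) (hε : B ≤ 2 * M * ε)
  (hε0 : 0 ≤ ε) (he : ε + Δ / 2 ^ L ≤ e)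
    {κ p r : ℝ} (hκ : ε ≤ κ) (hp0 : 0 ≤ p) (hpr : p ≤ r) (hr1 : r ≤ 1)
    (hp : cumF vB p ≤ 1 / 2 + κ) (hr : 1 / 2 - κ ≤ cumF vB r) :
    Sat (lossB k vB) (fun y => p ≤ y ∧ y ≤ r ∧
      |cumF vB y - cumF vB p + 1 / 2 - cumF vB r| ≤ κ + (e - ε))
      (adv k M L r p) (L * (M + M)) B := by
  have hΔ : 0 < Δ := hδ.trans_le hδΔ
  have hval : ∀ y, p ≤ y → y ≤ r → val k (cumF vB) (cut3 k p y r).1 false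
      = cumF vB y - cumF vB p + (1 - cumF vB r) := by
    intro z h1 h2
    rw [val_cut3 hk _ hp0 h1 h2 hr1, cumF_one hB]
  refine Sat.mono ?_ _ le_rfl le_rfl (sat_bis (lossB_nonneg k vB) hB0
    (H := fun y => val k (cumF vB) (cut3 k p y r).1 false) (κ := κ) (D := Δ) (lo₀ := p) (hi₀ := r)
    ?_ ?_ ?_ L p r le_rfl hpr le_rfl ?_ ?_)
  · rintro z ⟨h1, h2, h3, h4⟩
    refine ⟨h1, h2, ?_⟩
    simp only [hval z h1 h2] at h3 h4
    have h5 : Δ * ((r - p) / 2 ^ L) ≤ Δ / 2 ^ L := by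
      rw [← mul_div_assoc]
      refine div_le_div_of_nonneg_right ?_ (by positivity)
      nlinarith
    have h6 : 0 ≤ Δ / 2 ^ L := by positivity
    rw [abs_le]
    constructor <;> linarith
  · intro a b h1 h2 h3
    rw [hval b (by linarith) (by linarith), hval a (by linarith) (by linarith)]
    have := cumF_upper hB (by linarith) h2 (by linarith)
    linarith
  · intro y h1 h2 h3
    exact (lossB_true hB hM hε _ h3).trans (by linarith)
  · intro y h1 h2 h3
    exact le_trans (by linarith) (lossB_false hB hM hε _ h3)
  · rw [hval p le_rfl hpr]; linarith
  · rw [hval r hpr le_rfl]; linarith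

lemma sat_chain {δ Δ : ℝ} (hδ : 0 < δ) (hδΔ : δ ≤ Δ) {vB : ℝ → ℝ} (hB : IsValueDensity δ Δ vB)
  {k M L : ℕ} (hk : 3 ≤ k) (hM : 1 ≤ M) {B ε e : ℝ} (hB0 : 0 ≤ B) (hε : B ≤ 2 * M * ε)
  (hε0 : 0 ≤ ε) (he : ε + Δ / 2 ^ L ≤ e)
    {m r w : ℝ} (hm0 : 0 ≤ m) (hmr : m ≤ r) (hr1 : r ≤ 1)
    (hm : |cumF vB m - 1 / 2| ≤ e) (hr : |cumF vB r - w - 1 / 2| ≤ e) (hw : 0 ≤ w)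
    (fuel₀ : ℕ) (hfuel : 1 < fuel₀ * (w - 3 * e)) :
    ∀ (f j : ℕ) (p : ℝ) (acc : ℕ → ℝ × ℝ), j + f = fuel₀ → 0 ≤ p → p ≤ r →
      |cumF vB p - j * w| ≤ 3 * j * e → (∀ i < j, GoodPt (cumF vB) w e i (acc i)) →
      Sat (lossB k vB) (GoodRes (cumF vB) w e fuel₀) (chain k M L m r f j p acc)
        (f * (2 * (L * (M + M)))) B := by
  have hΔ : 0 < Δ := hδ.trans_le hδΔ
  have hΔL : 0 ≤ Δ / 2 ^ L := by positivity
  have he' : ε ≤ e := by linarith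
  have hmono : ∀ x y, 0 ≤ x → x ≤ y → y ≤ 1 → cumF vB x ≤ cumF vB y := by
    intro x y h1 h2 h3
    have := cumF_lower hB h1 h2 h3
    have h4 : 0 ≤ δ * (y - x) := mul_nonneg hδ.le (by linarith)
    linarith
  rw [abs_le] at hm hr
  intro f
  induction f with
  | zero =>
    intro j p acc hj hp0 hpr hp hacc
    exfalso
    have : j = fuel₀ := by omega
    subst this
    rw [abs_le] at hp
    have := hmono p 1 hp0 (by linarith) le_rfl
    rw [cumF_one hB] at this
    linarith
  | succ f ih =>
    intro j p acc hj hp0 hpr hp hacc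
    rw [chain]
    split_ifs with hmp
    · rw [abs_le] at hp
      have := hmono m p hm0 hmp.le (by linarith)
      refine ⟨by simp only; omega, ?_, hacc⟩
      simp only
      linarith
    · push Not at hmp
      have hFp : cumF vB p ≤ 1 / 2 + e := by
        have := hmono p m hp0 hmp (by linarith)
        linarith
      rw [show (f + 1) * (2 * (L * (M + M))) =
        L * (M + M) + (L * (M + M) + f * (2 * (L * (M + M)))) by ring]
      refine Sat.bind (lossB_nonneg k vB) ?_ _ le_rfl
        (sat_opp hδ hδΔ hB hk hM hB0 hε hε0 he he' hp0 (by linarith) hFp)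
      rintro z ⟨hz1, hz2, hz3⟩
      refine Sat.bind (lossB_nonneg k vB) ?_ _ le_rfl
        (sat_adv hδ hδΔ hB hk hM hB0 hε hε0 he he' hp0 (by linarith) hr1 hFp (by linarith))
      rintro y ⟨hy1, hy2, hy3⟩
      refine ih (j + 1) y _ (by omega) (by linarith) hy2 ?_ ?_
      · rw [abs_le] at hy3 hp ⊢
        push_cast
        constructor <;> linarith
      · intro i hi
        by_cases hij : i = j
        · subst hij
          rw [Function.update_self]
          refine ⟨⟨hp0, by simp only; linarith⟩, ⟨by simp only; linarith, hz2⟩, hp, hFp, ?_⟩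
          exact hz3.trans (by linarith)
        · rw [Function.update_of_ne hij]
          exact hacc i (by omega)

lemma sat_learn {δ Δ : ℝ} (hδ : 0 < δ) (hδΔ : δ ≤ Δ) {vB : ℝ → ℝ} (hB : IsValueDensity δ Δ vB)
  {k M L : ℕ} (hk : 3 ≤ k) (hM : 1 ≤ M) {B ε e : ℝ} (hB0 : 0 ≤ B) (hε : B ≤ 2 * M * ε)
  (hε0 : 0 ≤ ε) (he : ε + Δ / 2 ^ L ≤ e)
    {η : ℝ} (hη0 : 0 ≤ η) (hη1 : η ≤ 1) (hηh : Δ * η ≤ 1 / 2)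
    (heη : 3 * e ≤ δ * η / 2) (fuel : ℕ) (hfuel : 1 < fuel * (δ * η / 2)) :
    Sat (lossB k vB) (GoodRes (cumF vB) (cumF vB η) e fuel) (learn k M L fuel η)
        ((fuel + 1) * (2 * (L * (M + M)))) B := by
  have hΔ : 0 < Δ := hδ.trans_le hδΔ
  have hΔL : 0 ≤ Δ / 2 ^ L := by positivity
  have he' : ε ≤ e := by linarith
  have hw1 := cumF_lower hB le_rfl hη0 hη1
  have hw2 := cumF_upper hB le_rfl hη0 hη1
  rw [cumF_zero] at hw1 hw2
  have hδη : 0 ≤ δ * η := by positivity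
  unfold learn
  rw [show (fuel + 1) * (2 * (L * (M + M))) =
        L * (M + M) + (L * (M + M) + fuel * (2 * (L * (M + M)))) by ring]
  refine Sat.bind (lossB_nonneg k vB) ?_ _ le_rfl
    (sat_opp hδ hδΔ hB hk hM hB0 hε hε0 he le_rfl le_rfl zero_le_one
      (by rw [cumF_zero]; linarith))
  rintro m ⟨hm1, hm2, hm3⟩
  rw [cumF_zero, sub_zero] at hm3
  refine Sat.bind (lossB_nonneg k vB) ?_ _ le_rfl
    (sat_opp hδ hδΔ hB hk hM hB0 hε hε0 he le_rfl hη0 hη1 (by linarith))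
  rintro r ⟨hr1, hr2, hr3⟩
  have hmr : m ≤ r := by
    by_contra hcon
    push Not at hcon
    have h1 := cumF_lower hB (by linarith) hcon.le hm2
    have h2 : 0 < δ * (m - r) := mul_pos hδ (by linarith)
    have h4 : 0 < δ * η := by
      rcases hδη.lt_or_eq with h | h
      · exact h
      · rw [← h] at hfuel; simp at hfuel; linarith
    rw [abs_le] at hm3 hr3
    linarith
  refine sat_chain hδ hδΔ hB hk hM hB0 hε hε0 he hm1 hmr hr2 (hm3.trans (by linarith))
    (hr3.trans (by linarith)) (by linarith) fuel ?_ fuel 0 0 _ (by omega) le_rfl (by linarith)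
    (by simp [cumF_zero]) (by simp)
  refine hfuel.trans_le (mul_le_mul_of_nonneg_left ?_ (Nat.cast_nonneg _))
  linarith



/-! ### Part 6: estimating the cumulative function -/

/-- recorded point -/
def ptOf (res : ℕ × (ℕ → ℝ × ℝ)) (q : ℕ × Bool) : ℝ :=
  if q.2 then (res.2 q.1).2 else (res.2 q.1).1

/-- estimated value at the recorded point -/
def ptVal (res : ℕ × (ℕ → ℝ × ℝ)) (q : ℕ × Bool) : ℝ :=
  q.1 / (2 * res.1) + if q.2 then 1 / 2 else 0

lemma exists_nearest (res : ℕ × (ℕ → ℝ × ℝ)) (x : ℝ) : ∃ q : ℕ × Bool, 0 < res.1 →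
    q.1 < res.1 ∧ ∀ q' : ℕ × Bool, q'.1 < res.1 → |x - ptOf res q| ≤ |x - ptOf res q'| := by
  by_cases h : 0 < res.1
  · obtain ⟨q, hq, hmin⟩ := Finset.exists_min_image
      (Finset.range res.1 ×ˢ (Finset.univ : Finset Bool)) (fun q => |x - ptOf res q|)
      ⟨(0, true), by simp [h]⟩
    refine ⟨q, fun _ => ⟨by simpa using hq, fun q' hq' => hmin q' (by simpa using hq')⟩⟩
  · exact ⟨(0, true), fun h' => absurd h' h⟩

/-- Estimated cumulative function. -/
def est (res : ℕ × (ℕ → ℝ × ℝ)) (x : ℝ) : ℝ := ptVal res (exists_nearest res x).choose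

lemma abs_cumF {δ Δ : ℝ} {v : ℝ → ℝ} (hv : IsValueDensity δ Δ v) {x y : ℝ}
    (hx : x ∈ Set.Icc (0:ℝ) 1) (hy : y ∈ Set.Icc (0:ℝ) 1) (hδ : 0 < δ) :
    δ * |x - y| ≤ |cumF v x - cumF v y| ∧ |cumF v x - cumF v y| ≤ Δ * |x - y| := by
  wlog h : y ≤ x generalizing x y
  · have := this hy hx (by linarith)
    rwa [abs_sub_comm y x, abs_sub_comm (cumF v y)] at this
  have h1 := cumF_lower hv hy.1 h hx.2
  have h2 := cumF_upper hv hy.1 h hx.2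
  have h3 : 0 ≤ δ * (x - y) := mul_nonneg hδ.le (by linarith)
  rw [abs_of_nonneg (by linarith : 0 ≤ x - y), abs_of_nonneg (by linarith)]
  exact ⟨h1, h2⟩

lemma est_error {δ Δ : ℝ} (hδ : 0 < δ) (hδΔ : δ ≤ Δ) {v : ℝ → ℝ} (hv : IsValueDensity δ Δ v)
    {w e E : ℝ} (hw : 0 < w) (he : 0 ≤ e) {fuel : ℕ} {res : ℕ × (ℕ → ℝ × ℝ)}
    (hres : GoodRes (cumF v) w e fuel res) (he2 : e + 3 * fuel * e < 1 / 2)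
    (hE : w + 3 * e + 6 * fuel * e ≤ E) :
    ∀ x ∈ Set.Icc (0:ℝ) 1, |est res x - cumF v x| ≤ (1 + Δ / δ) * (2 * E) := by
  obtain ⟨hN, hNw, hgood⟩ := hres
  set N := res.1 with hNdef
  have hΔ : 0 < Δ := hδ.trans_le hδΔ
  have hNf : (N:ℝ) ≤ fuel := by exact_mod_cast hN
  have hNe : 3 * (N:ℝ) * e ≤ 3 * fuel * e := by gcongr
  have hfe : 0 ≤ 3 * (fuel:ℝ) * e := by positivity
  have hN0 : 0 < N := by
    by_contra h
    have h0 : N = 0 := by omega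
    rw [h0] at hNw
    simp at hNw
    linarith
  have hN0' : (0:ℝ) < N := by exact_mod_cast hN0
  have hie : ∀ i < N, 3 * (i:ℝ) * e ≤ 3 * fuel * e := by
    intro i hi
    have : (i:ℝ) ≤ fuel := by exact_mod_cast (by omega : i ≤ fuel)
    gcongr
  -- upper bound on N w
  have hNw2 : N * w ≤ 1 / 2 + w + e + 3 * fuel * e := by
    obtain ⟨n, hn⟩ : ∃ n, N = n + 1 := ⟨N - 1, by omega⟩
    have h := hgood n (by omega)
    have h1 := abs_le.1 h.2.2.1
    have h2 := h.2.2.2.1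
    have h3 := hie n (by omega)
    rw [hn]; push_cast
    linarith
  have hu : ∀ i < N, |i * w - i / (2 * N)| ≤ w + e + 3 * fuel * e := by
    intro i hi
    have hi' : (i:ℝ) ≤ N := by exact_mod_cast hi.le
    have h1 : i * w - i / (2 * N) = (i / N) * (N * w - 1 / 2) := by field_simp
    rw [h1, abs_mul]
    have h2 : |(i:ℝ) / N| ≤ 1 := by
      rw [abs_of_nonneg (by positivity)]
      exact (div_le_one hN0').2 hi'
    have h3 : |N * w - 1 / 2| ≤ w + e + 3 * fuel * e := by
      rw [abs_le]; constructor <;> linarith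
    calc _ ≤ 1 * |N * w - 1 / 2| := by gcongr
      _ ≤ _ := by linarith
  -- recorded values are accurate
  have hmem : ∀ q : ℕ × Bool, q.1 < N → ptOf res q ∈ Set.Icc (0:ℝ) 1 := by
    intro q hq
    unfold ptOf
    split_ifs
    · exact (hgood _ hq).2.1
    · exact (hgood _ hq).1
  have hacc0 : ∀ i < N, ∀ b : Bool, |cumF v (ptOf res (i, b)) -
      (i * w + if b then 1 / 2 else 0)| ≤ 2 * e + 3 * fuel * e := by
    intro i hi b
    have h := hgood i hi
    have h1 := abs_le.1 h.2.2.1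
    have h2 := abs_le.1 h.2.2.2.2
    have h3 := hie i hi
    unfold ptOf
    cases b
    · simp only [Bool.false_eq_true, if_false]
      rw [abs_le]; constructor <;> linarith
    · simp only [if_true]
      rw [abs_le]; constructor <;> linarith
  have hacc : ∀ q : ℕ × Bool, q.1 < N → |ptVal res q - cumF v (ptOf res q)| ≤ E := by
    rintro ⟨i, b⟩ hi
    have h1 := abs_le.1 (hacc0 i hi b)
    have h2 := abs_le.1 (hu i hi)
    unfold ptVal
    simp only
    rw [abs_le]; constructor <;> linarith
  -- covering
  have hcov0 : ∀ s : ℝ, 0 ≤ s → s ≤ 1 / 2 → ∃ i < N, |s - i * w| ≤ w + e + 3 * fuel * e := by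
    intro s hs0 hs1
    by_cases h : ⌊s / w⌋₊ < N
    · refine ⟨_, h, ?_⟩
      have h1 := Nat.floor_le (div_nonneg hs0 hw.le)
      have h2 := Nat.lt_floor_add_one (s / w)
      rw [le_div_iff₀ hw] at h1
      rw [div_lt_iff₀ hw] at h2
      rw [abs_le]; constructor <;> linarith
    · push Not at h
      have h1 := Nat.floor_le (div_nonneg hs0 hw.le)
      rw [le_div_iff₀ hw] at h1
      have h3 : (N:ℝ) * w ≤ ⌊s / w⌋₊ * w := by gcongr
      obtain ⟨n, hn⟩ : ∃ n, N = n + 1 := ⟨N - 1, by omega⟩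
      refine ⟨n, by omega, ?_⟩
      have h4 : (N:ℝ) * w = n * w + w := by rw [hn]; push_cast; ring
      rw [abs_le]; constructor <;> linarith
  have hcov : ∀ x ∈ Set.Icc (0:ℝ) 1, ∃ q : ℕ × Bool, q.1 < N ∧
      |cumF v x - cumF v (ptOf res q)| ≤ E := by
    intro x hx
    have hF0 : 0 ≤ cumF v x := by
      have := cumF_lower hv le_rfl hx.1 hx.2
      rw [cumF_zero] at this
      have h2 : 0 ≤ δ * (x - 0) := mul_nonneg hδ.le (by linarith [hx.1])
      linarith
    have hF1 : cumF v x ≤ 1 := by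
      have := cumF_lower hv hx.1 hx.2 le_rfl
      rw [cumF_one hv] at this
      have h2 : 0 ≤ δ * (1 - x) := mul_nonneg hδ.le (by linarith [hx.2])
      linarith
    by_cases h : cumF v x ≤ 1 / 2
    · obtain ⟨i, hi, h1⟩ := hcov0 _ hF0 h
      refine ⟨(i, false), hi, ?_⟩
      have h2 := abs_le.1 (hacc0 i hi false)
      rw [abs_le] at h1
      simp only [Bool.false_eq_true, if_false] at h2
      rw [abs_le]; constructor <;> linarith
    · obtain ⟨i, hi, h1⟩ := hcov0 (cumF v x - 1 / 2) (by linarith) (by linarith)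
      refine ⟨(i, true), hi, ?_⟩
      have h2 := abs_le.1 (hacc0 i hi true)
      rw [abs_le] at h1
      simp only [if_true] at h2
      rw [abs_le]; constructor <;> linarith
  intro x hx
  obtain ⟨q', hq', hq2⟩ := hcov x hx
  obtain ⟨hq, hmin⟩ := (exists_nearest res x).choose_spec hN0
  unfold est
  set q := (exists_nearest res x).choose
  have h1 := hmin q' hq'
  have h2 := (abs_cumF hv hx (hmem q' hq') hδ).1
  have h3 := (abs_cumF hv hx (hmem q hq) hδ).2
  have h4 := hacc q hq
  have hE0 : 0 ≤ E := le_trans (abs_nonneg _) h4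
  have h5 : |x - ptOf res q'| ≤ E / δ := by
    rw [le_div_iff₀ hδ]; linarith
  have h6 : Δ * |x - ptOf res q| ≤ Δ / δ * E := by
    calc _ ≤ Δ * (E / δ) := by gcongr; linarith
      _ = _ := by ring
  have h7 : 0 ≤ Δ / δ * E := by positivity
  calc |ptVal res q - cumF v x|
      ≤ |ptVal res q - cumF v (ptOf res q)| + |cumF v (ptOf res q) - cumF v x| := abs_sub_le _ _ _
    _ ≤ E + Δ / δ * E := by
        rw [abs_sub_comm (cumF v (ptOf res q))]
        linarith
    _ ≤ (1 + Δ / δ) * (2 * E) := by nlinarith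

/-! ### Part 7: the exploitation cut -/

/-- candidate partitions with estimated margin -/
def Cand (k : ℕ) (G : ℝ → ℝ) (μ : ℝ) (cb : Cut k × Bool) : Prop :=
  1 / 2 + μ ≤ val k G cb.1.1 (!cb.2)

lemma exists_best {δ Δ : ℝ} (hδ : 0 < δ) {vA : ℝ → ℝ} (hA : IsValueDensity δ Δ vA) (k : ℕ)
    (G : ℝ → ℝ) (μ : ℝ) : ∃ cb : Cut k × Bool, 0 < μ → (∃ cb', Cand k G μ cb') →
      Cand k G μ cb ∧ ∀ cb', Cand k G μ cb' →
        val k (cumF vA) cb'.1.1 cb'.2 - μ ≤ val k (cumF vA) cb.1.1 cb.2 := by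
  by_cases h : 0 < μ ∧ ∃ cb', Cand k G μ cb'
  · obtain ⟨hμ, cb₀, h0⟩ := h
    set S : Set ℝ := {u | ∃ cb', Cand k G μ cb' ∧ u = val k (cumF vA) cb'.1.1 cb'.2} with hS
    have hne : S.Nonempty := ⟨_, cb₀, h0, rfl⟩
    have hbdd : BddAbove S := by
      refine ⟨1, ?_⟩
      rintro u ⟨cb', _, rfl⟩
      exact val_le_one hδ hA cb'.1.2 _
    obtain ⟨u, ⟨cb, hcb, rfl⟩, hu⟩ := exists_lt_of_lt_csSup hne (show sSup S - μ < sSup S by linarith)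
    refine ⟨cb, fun _ _ => ⟨hcb, fun cb' hcb' => ?_⟩⟩
    have := le_csSup hbdd (show _ ∈ S from ⟨cb', hcb', rfl⟩)
    linarith
  · exact ⟨(cut3 k 0 0 0, true), fun h1 h2 => absurd ⟨h1, h2⟩ h⟩

lemma stack_le_one {δ Δ : ℝ} (hδ : 0 < δ) {vA vB : ℝ → ℝ}
    (hA : IsValueDensity δ Δ vA) (hB : IsValueDensity δ Δ vB) (k : ℕ) {K : ℝ}
    (h : ∀ (c : Cut k) (b : Bool), 1 / 2 ≤ val k (cumF vB) c.1 (!b) →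
      val k (cumF vA) c.1 b ≤ K) : stackelbergValue k vA vB ≤ K := by
  unfold stackelbergValue
  apply csSup_le
  · have hc := (cut3 k 0 0 0).2
    by_cases h : 1 / 2 ≤ val k (cumF vB) (cut3 k 0 0 0).1 false
    · exact ⟨_, (cut3 k 0 0 0).1, true, hc, by rw [pieceVal_eq hB hc]; exact h, rfl⟩
    · refine ⟨_, (cut3 k 0 0 0).1, false, hc, ?_, rfl⟩
      rw [pieceVal_eq hB hc, val_compl hB]; linarith
  · rintro u ⟨c, b, hc, h1, rfl⟩
    rw [pieceVal_eq hB hc] at h1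
    rw [pieceVal_eq hA hc]
    exact h ⟨c, hc⟩ b h1

/-- The chosen exploitation partition. -/
def best {δ Δ : ℝ} (hδ : 0 < δ) {vA : ℝ → ℝ} (hA : IsValueDensity δ Δ vA) (k : ℕ)
    (G : ℝ → ℝ) (μ : ℝ) : Cut k × Bool := (exists_best hδ hA k G μ).choose

lemma best_spec {δ Δ : ℝ} (hδ : 0 < δ) (hδΔ : δ ≤ Δ) {vA vB : ℝ → ℝ}
    (hA : IsValueDensity δ Δ vA) (hB : IsValueDensity δ Δ vB) {k : ℕ} (hk : 1 ≤ k)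
    {G : ℝ → ℝ} {μ E : ℝ} (hμ : 0 < μ) (hμ1 : 2 * μ ≤ 1 / 4)
    (hμ2 : Δ * (2 * μ / δ) * (k + 1) ≤ 1 / 4)
    (hG : ∀ x ∈ Set.Icc (0:ℝ) 1, |G x - cumF vB x| ≤ E) (hE : (k + 1) * (2 * E) ≤ μ / 2) :
    1 / 2 + μ / 2 ≤ val k (cumF vB) (best hδ hA k G μ).1.1 (!(best hδ hA k G μ).2) ∧
    stackelbergValue k vA vB ≤ val k (cumF vA) (best hδ hA k G μ).1.1 (best hδ hA k G μ).2
      + (μ + Δ * (2 * μ / δ)) := by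
  have key : ∀ (c : Cut k) (b : Bool), 1 / 2 ≤ val k (cumF vB) c.1 (!b) →
      ∃ cb', Cand k G μ cb' ∧ val k (cumF vA) c.1 b - Δ * (2 * μ / δ) ≤
        val k (cumF vA) cb'.1.1 cb'.2 := by
    intro c b hf
    obtain ⟨c', hc', h1, h2⟩ := shrink hδ hδΔ hA hB hk c.2 b hμ hμ1 hμ2 hf
    refine ⟨(⟨c', hc'⟩, b), ?_, h2⟩
    have := abs_le.1 (val_approx hG hc' (!b))
    unfold Cand
    simp only
    linarith
  have hne : ∃ cb', Cand k G μ cb' := by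
    by_cases h : 1 / 2 ≤ val k (cumF vB) (cut3 k 0 0 0).1 (!true)
    · obtain ⟨cb, h1, _⟩ := key _ _ h
      exact ⟨cb, h1⟩
    · have h' : 1 / 2 ≤ val k (cumF vB) (cut3 k 0 0 0).1 (!false) := by
        rw [val_compl hB] at h ⊢
        have := val_compl hB (cut3 k 0 0 0).1 false
        simp only [Bool.not_false] at this
        linarith
      obtain ⟨cb, h1, _⟩ := key _ _ h'
      exact ⟨cb, h1⟩
  obtain ⟨h1, h2⟩ := (exists_best hδ hA k G μ).choose_spec hμ hne
  have hbest : best hδ hA k G μ = (exists_best hδ hA k G μ).choose := rfl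
  rw [← hbest] at h1 h2
  constructor
  · have := abs_le.1 (val_approx hG (best hδ hA k G μ).1.2 (!(best hδ hA k G μ).2))
    unfold Cand at h1
    linarith
  · refine stack_le_one hδ hA hB k fun c b hf => ?_
    obtain ⟨cb', h3, h4⟩ := key c b hf
    have := h2 cb' h3
    linarith


/-! ### Part 8: the strategy and its regret -/

/-- Alice's strategy from a program and an exploitation rule. -/
def progStrat {k : ℕ} {β : Type} (p : ℕ → Prog k β) (g : ℕ → β → Cut k) : AliceStrategy k :=
  fun T h => (head (g T) (resid (p T) h)).1

lemma regret_bound {δ Δ : ℝ} (hδ : 0 < δ) {vA vB : ℝ → ℝ}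
    (hA : IsValueDensity δ Δ vA) (hB : IsValueDensity δ Δ vB) {k : ℕ} {β : Type}
    (p : ℕ → Prog k β) (g : ℕ → β → Cut k × Bool) (SB : BobStrategy k) (T n : ℕ) {B μ K : ℝ}
    (hμ : 0 < μ) (hK : 0 ≤ K)
    (hbob : bobRegret k vB (progStrat p (fun T r => (g T r).1)) SB T ≤ B)
    (hsat : Sat (lossB k vB) (fun r =>
      1 / 2 + μ / 2 ≤ val k (cumF vB) (g T r).1.1 (!(g T r).2) ∧
      stackelbergValue k vA vB ≤ val k (cumF vA) (g T r).1.1 (g T r).2 + K) (p T) n B) :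
    aliceRegret k vA vB (progStrat p (fun T r => (g T r).1)) SB T ≤ n + T * K + B / μ := by
  set g' : ℕ → β → Cut k := fun T r => (g T r).1 with hg'
  set SA := progStrat p g' with hSA
  set P : ℕ → Prog k β := fun t => resid (p T) (playHist k SA SB T t) with hP
  set a : ℕ → Bool := fun t => roundChoice k SA SB T t with ha
  have hcut : ∀ t, roundCuts k SA SB T t = (head (g' T) (P t)).1 := fun t => rfl
  have hstep : ∀ t, P (t + 1) = step (P t) (a t) := by
    intro t
    exact resid_append (p T) _ _ _
  have h0 : P 0 = p T := rfl
  have hbob' : ∑ s ∈ Finset.range T, lossB k vB (head (g' T) (P s)) (a s) ≤ B := by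
    refine le_trans (le_of_eq ?_) hbob
    unfold bobRegret
    refine Finset.sum_congr rfl fun t _ => ?_
    rw [hcut, pieceVal_eq hB (head (g' T) (P t)).2, pieceVal_eq hB (head (g' T) (P t)).2,
      pieceVal_eq hB (head (g' T) (P t)).2]
    rfl
  have hu1 : stackelbergValue k vA vB ≤ 1 :=
    stack_le_one hδ hA hB k fun c b _ => val_le_one hδ hA c.2 b
  have hterm : ∀ t ∈ Finset.range T, stackelbergValue k vA vB -
      pieceVal vA (altPiece k (roundCuts k SA SB T t) (!(roundChoice k SA SB T t))) ≤
      (if t < n then 1 else 0) + K + lossB k vB (head (g' T) (P t)) (a t) / μ := by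
    intro t ht
    rw [hcut, pieceVal_eq hA (head (g' T) (P t)).2]
    have hl := lossB_nonneg k vB (head (g' T) (P t)) (a t)
    have hl' := div_nonneg hl hμ.le
    have hv := val_nonneg hδ hA (head (g' T) (P t)).2 (!(roundChoice k SA SB T t))
    split_ifs with htn
    · linarith
    · obtain ⟨r, hr, hr1, hr2⟩ := sat_run_done (lossB_nonneg k vB) (g' T) P a hstep
        (h0 ▸ hsat) T hbob' t (Finset.mem_range.1 ht) (by omega)
      have hh : head (g' T) (P t) = (g T r).1 := by rw [hr]; rfl
      rw [hh] at hl hl' hv ⊢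
      by_cases hch : roundChoice k SA SB T t = !(g T r).2
      · rw [hch, Bool.not_not]
        linarith
      · have hch' : roundChoice k SA SB T t = (g T r).2 := by
          revert hch
          cases roundChoice k SA SB T t <;> cases (g T r).2 <;> simp
        have : μ ≤ lossB k vB (g T r).1 (a t) := by
          have e1 : a t = (g T r).2 := hch'
          rw [e1]
          unfold lossB
          have e2 := val_compl hB (g T r).1.1 (g T r).2
          have e3 : val k (cumF vB) (g T r).1.1 (!(g T r).2) ≤
              max (val k (cumF vB) (g T r).1.1 true) (val k (cumF vB) (g T r).1.1 false) := by
            cases (g T r).2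
            · exact le_max_left _ _
            · exact le_max_right _ _
          linarith
        have := (one_le_div hμ).2 this
        linarith
  unfold aliceRegret
  refine (Finset.sum_le_sum hterm).trans ?_
  rw [Finset.sum_add_distrib, Finset.sum_add_distrib, ← Finset.sum_div]
  have s1 : ∑ t ∈ Finset.range T, (if t < n then (1:ℝ) else 0) ≤ n := by
    rw [← Finset.sum_filter, Finset.sum_const, nsmul_eq_mul, mul_one]
    have : (Finset.filter (fun t => t < n) (Finset.range T)).card ≤ (Finset.range n).card := by
      refine Finset.card_le_card fun x hx => ?_
      rw [Finset.mem_filter] at hx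
      exact Finset.mem_range.2 hx.2
    rw [Finset.card_range] at this
    exact_mod_cast this
  have s2 : ∑ t ∈ Finset.range T, K = T * K := by simp
  have s3 := div_le_div_of_nonneg_right hbob' hμ.le
  rw [s2]
  linarith

/-- Number of repetitions. -/
def repM (α : ℝ) (η : ℝ) (T : ℕ) : ℕ := ⌈(T:ℝ) ^ α / η ^ 2⌉₊

/-- Maximal number of steps of the walk. -/
def fuelN (δ η : ℝ) : ℕ := ⌊2 / (δ * η)⌋₊ + 1

lemma core_bound {δ Δ : ℝ} (hδ : 0 < δ) (hδΔ : δ ≤ Δ) {vA vB : ℝ → ℝ}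
    (hA : IsValueDensity δ Δ vA) (hB : IsValueDensity δ Δ vB) {k : ℕ} (hk : 3 ≤ k) {α c : ℝ}
    (hc : 0 < c) (η μ : ℕ → ℝ) (SB : BobStrategy k) (T : ℕ)
    (SA : AliceStrategy k) (hSA : SA = progStrat
      (fun T => learn k (repM α (η T) T) (Nat.log 2 T + 1) (fuelN δ (η T)) (η T))
      (fun T r => (best hδ hA k (est r) (μ T)).1))
    (hbob : bobRegret k vB SA SB T ≤ c * (T:ℝ) ^ α)
    {ℓ : ℝ} (hT : 1 ≤ T) (hℓ1 : 1 ≤ ℓ) (hL : ((Nat.log 2 T + 1 : ℕ) : ℝ) ≤ 3 * ℓ)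
    (hη0 : 0 < η T) (hη1 : η T ≤ 1) (hημ : η T ≤ μ T)
    (f2 : (T:ℝ) ^ α * ℓ = T * η T ^ 4) (f3 : 1 ≤ T * η T ^ 2) (f4 : ℓ ≤ T * η T ^ 2)
    (f5 : (T:ℝ) ^ α ≤ T * μ T ^ 2)
    (r5 : 3 * (c / 2 + Δ) * η T ≤ δ / 2) (r6 : Δ * η T ≤ 1 / 2)
    (r7 : (c / 2 + Δ) * (4 + 6 / δ) * η T < 1 / 2)
    (r9 : (k + 1) * (2 * ((1 + Δ / δ) * (2 * ((Δ + (c / 2 + Δ) * (9 + 12 / δ)) * η T)))) ≤ μ T / 2)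
    (r10 : 2 * μ T ≤ 1 / 4) (r11 : Δ * (2 * μ T / δ) * (k + 1) ≤ 1 / 4) :
    aliceRegret k vA vB SA SB T ≤
      (24 * (2 / δ + 2) + c + (1 + Δ * (2 / δ))) * (T * μ T) := by
  have hΔ : 0 < Δ := hδ.trans_le hδΔ
  have hT0 : (0:ℝ) < T := by exact_mod_cast hT
  have hTα : 0 < (T:ℝ) ^ α := Real.rpow_pos_of_pos hT0 _
  have hμ0 : 0 < μ T := hη0.trans_le hημ
  set h := η T with hh
  set m := μ T with hm
  set M := repM α h T with hM
  set L := Nat.log 2 T + 1 with hLdef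
  set fu := fuelN δ h with hfu
  have hMge : (T:ℝ) ^ α / h ^ 2 ≤ M := Nat.le_ceil _
  have hMle : (M:ℝ) ≤ (T:ℝ) ^ α / h ^ 2 + 1 := (Nat.ceil_lt_add_one (by positivity)).le
  have hM1 : 1 ≤ M := Nat.ceil_pos.2 (by positivity)
  have hfge : 2 / (δ * h) < fu := by
    rw [hfu]; unfold fuelN; push_cast; exact Nat.lt_floor_add_one _
  have hfle : (fu:ℝ) ≤ 2 / (δ * h) + 1 := by
    rw [hfu]; unfold fuelN; push_cast
    linarith [Nat.floor_le (show 0 ≤ 2 / (δ * h) by positivity)]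
  set e := (c / 2 + Δ) * h ^ 2 with he
  have he0 : 0 ≤ e := by positivity
  have h2L : (T:ℝ) ≤ 2 ^ L := by
    have := Nat.lt_pow_succ_log_self (b := 2) (by norm_num) T
    exact_mod_cast this.le
  have hfe : fu * e ≤ (c / 2 + Δ) * (2 / δ * h + h ^ 2) := by
    calc fu * e ≤ (2 / (δ * h) + 1) * e := by gcongr
      _ = _ := by rw [he]; field_simp
  have hh2 : h ^ 2 ≤ h := by nlinarith
  have hcΔ : 0 < c / 2 + Δ := by positivity
  have hfe' : fu * e ≤ (c / 2 + Δ) * (2 / δ + 1) * h := by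
    calc fu * e ≤ (c / 2 + Δ) * (2 / δ * h + h ^ 2) := hfe
      _ ≤ (c / 2 + Δ) * (2 / δ * h + h) := by gcongr
      _ = _ := by ring
  have hee : e ≤ (c / 2 + Δ) * h := by rw [he]; gcongr
  have hw1 := cumF_lower hB le_rfl hη0.le hη1
  have hw2 := cumF_upper hB le_rfl hη0.le hη1
  rw [cumF_zero, sub_zero, sub_zero] at hw1 hw2
  have hδh : 0 < δ * h := by positivity
  have hsat : Sat (lossB k vB) (GoodRes (cumF vB) (cumF vB h) e fu) (learn k M L fu h)
      ((fu + 1) * (2 * (L * (M + M)))) (c * (T:ℝ) ^ α) := by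
    refine sat_learn (ε := c / 2 * h ^ 2) hδ hδΔ hB hk hM1 (by positivity) ?_ (by positivity) ?_
      hη0.le hη1 r6 ?_ fu ?_
    · rw [div_le_iff₀ (by positivity)] at hMge
      calc c * (T:ℝ) ^ α ≤ c * (M * h ^ 2) := by gcongr
        _ = _ := by ring
    · have : Δ / 2 ^ L ≤ Δ * h ^ 2 := by
        rw [div_le_iff₀ (by positivity)]
        calc Δ = Δ * 1 := by ring
          _ ≤ Δ * (T * h ^ 2) := by gcongr
          _ ≤ Δ * (2 ^ L * h ^ 2) := by gcongr
          _ = _ := by ring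
      rw [he]; linarith
    · rw [he]
      calc 3 * ((c / 2 + Δ) * h ^ 2) = (3 * (c / 2 + Δ) * h) * h := by ring
        _ ≤ δ / 2 * h := by gcongr
        _ = _ := by ring
    · rw [div_lt_iff₀ hδh] at hfge
      linarith
  have hsat2 : Sat (lossB k vB) (fun r =>
      1 / 2 + m / 2 ≤ val k (cumF vB) (best hδ hA k (est r) m).1.1
        (!(best hδ hA k (est r) m).2) ∧
      stackelbergValue k vA vB ≤ val k (cumF vA) (best hδ hA k (est r) m).1.1
        (best hδ hA k (est r) m).2 + (m + Δ * (2 * m / δ))) (learn k M L fu h)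
      ((fu + 1) * (2 * (L * (M + M)))) (c * (T:ℝ) ^ α) := by
    refine Sat.mono ?_ _ le_rfl le_rfl hsat
    intro r hr
    refine best_spec hδ hδΔ hA hB (by omega) hμ0 r10 r11
      (est_error hδ hδΔ hB (E := (Δ + (c / 2 + Δ) * (9 + 12 / δ)) * h) (by linarith) he0 hr ?_ ?_) r9
    · have : (c / 2 + Δ) * (4 + 6 / δ) * h = (c / 2 + Δ) * h + 3 * ((c / 2 + Δ) * (2 / δ + 1) * h) := by
        ring
      linarith
    · have : (Δ + (c / 2 + Δ) * (9 + 12 / δ)) * h =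
          Δ * h + 3 * ((c / 2 + Δ) * h) + 6 * ((c / 2 + Δ) * (2 / δ + 1) * h) := by
        ring
      linarith
  subst hSA
  have hK0 : 0 ≤ m + Δ * (2 * m / δ) := by positivity
  have main := regret_bound hδ hA hB
    (fun T => learn k (repM α (η T) T) (Nat.log 2 T + 1) (fuelN δ (η T)) (η T))
    (fun T r => best hδ hA k (est r) (μ T)) SB T _ hμ0 hK0 hbob hsat2
  refine main.trans ?_
  have hB' : c * (T:ℝ) ^ α / m ≤ c * (T * m) := by
    rw [div_le_iff₀ hμ0]
    calc c * (T:ℝ) ^ α ≤ c * (T * m ^ 2) := by gcongr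
      _ = _ := by ring
  have hn : (((fu + 1) * (2 * (L * (M + M))) : ℕ) : ℝ) ≤ 24 * (2 / δ + 2) * (T * m) := by
    have q1 : (fu:ℝ) + 1 ≤ (2 / δ + 2) / h := by
      rw [le_div_iff₀ hη0]
      calc ((fu:ℝ) + 1) * h ≤ (2 / (δ * h) + 1 + 1) * h := by gcongr
        _ = 2 / δ + 2 * h := by field_simp; ring
        _ ≤ _ := by linarith
    have q2 : ℓ * (M:ℝ) ≤ 2 * (T * h ^ 2) := by
      calc ℓ * (M:ℝ) ≤ ℓ * ((T:ℝ) ^ α / h ^ 2 + 1) := by gcongr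
        _ = ((T:ℝ) ^ α * ℓ) / h ^ 2 + ℓ := by ring
        _ = T * h ^ 2 + ℓ := by rw [f2]; field_simp
        _ ≤ _ := by linarith
    push_cast at hL ⊢
    calc ((fu:ℝ) + 1) * (2 * (L * (M + M))) = ((fu:ℝ) + 1) * (4 * (L * M)) := by ring
      _ ≤ (2 / δ + 2) / h * (4 * (3 * ℓ * M)) := by gcongr
      _ = (2 / δ + 2) / h * (12 * (ℓ * M)) := by ring
      _ ≤ (2 / δ + 2) / h * (12 * (2 * (T * h ^ 2))) := by gcongr
      _ = 24 * (2 / δ + 2) * (T * h) := by field_simp; ring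
      _ ≤ _ := by gcongr
  have e3 : T * (m + Δ * (2 * m / δ)) = (1 + Δ * (2 / δ)) * (T * m) := by ring
  rw [e3]
  linarith


/-! ### Part 9: asymptotics -/

/-- Resolution used while learning. -/
def etaF (α : ℝ) (T : ℕ) : ℝ := (T:ℝ) ^ (-((1 - α) / 4)) * Real.log T ^ ((1:ℝ) / 4)

/-- Safety margin used while exploiting. -/
def muF (α : ℝ) (T : ℕ) : ℝ := (T:ℝ) ^ (-((1 - α) / 4)) * Real.log T ^ ((1:ℝ) / 2)

lemma muF_eq (α : ℝ) {T : ℕ} (h : 0 < Real.log T) :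
    muF α T = etaF α T * Real.log T ^ ((1:ℝ) / 4) := by
  unfold muF etaF
  rw [mul_assoc, ← Real.rpow_add h]
  norm_num

lemma tendsto_muF {α : ℝ} (hα : α < 1) :
    Filter.Tendsto (muF α) Filter.atTop (nhds 0) := by
  have h := isLittleO_log_rpow_rpow_atTop (s := (1 - α) / 4) ((1:ℝ) / 2) (by linarith)
  have h2 := h.tendsto_div_nhds_zero.comp tendsto_natCast_atTop_atTop
  refine h2.congr fun T => ?_
  simp only [Function.comp, muF]
  rw [Real.rpow_neg (by positivity), div_eq_inv_mul]

lemma tendsto_logpow :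
    Filter.Tendsto (fun T : ℕ => Real.log T ^ ((1:ℝ) / 4)) Filter.atTop Filter.atTop :=
  (tendsto_rpow_atTop (by norm_num)).comp
    (Real.tendsto_log_atTop.comp tendsto_natCast_atTop_atTop)

lemma eventually_log_le {α : ℝ} (hα : -1 < α) :
    ∀ᶠ T : ℕ in Filter.atTop, Real.log T ≤ (T:ℝ) ^ (1 + α) := by
  have h := isLittleO_log_rpow_atTop (r := 1 + α) (by linarith)
  have h2 := (h.bound (c := 1) one_pos)
  have h3 := tendsto_natCast_atTop_atTop (R := ℝ) |>.eventually h2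
  filter_upwards [h3] with T hT
  rw [one_mul, Real.norm_of_nonneg (by positivity : (0:ℝ) ≤ (T:ℝ) ^ (1 + α))] at hT
  exact (le_abs_self _).trans hT

lemma natlog_le {T : ℕ} (hT : 1 ≤ T) (hℓ : 1 ≤ Real.log T) :
    ((Nat.log 2 T + 1 : ℕ) : ℝ) ≤ 3 * Real.log T := by
  have h1 : ((2 ^ Nat.log 2 T : ℕ) : ℝ) ≤ T := by
    exact_mod_cast Nat.pow_log_le_self 2 (by omega)
  have h2 := Real.log_le_log (by positivity) h1
  push_cast at h2 ⊢
  rw [Real.log_pow] at h2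
  have h3 := Real.log_two_gt_d9
  have h4 : (0:ℝ) ≤ (Nat.log 2 T : ℝ) := by positivity
  nlinarith

lemma eta_facts {α : ℝ} (hα : α < 1) {T : ℕ} (hT : 1 ≤ T) (hℓ : 1 ≤ Real.log T)
    (hlog : Real.log T ≤ (T:ℝ) ^ (1 + α)) :
    0 < etaF α T ∧ etaF α T ≤ muF α T ∧ (T:ℝ) ^ α * Real.log T = T * etaF α T ^ 4 ∧
    Real.log T ≤ T * etaF α T ^ 2 ∧ (T:ℝ) ^ α ≤ T * muF α T ^ 2 ∧
    T * muF α T = (T:ℝ) ^ ((3 + α) / 4) * Real.log T ^ ((1:ℝ) / 2) := by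
  have hT0 : (0:ℝ) < T := by exact_mod_cast hT
  have hT1 : (1:ℝ) ≤ T := by exact_mod_cast hT
  have hℓ0 : 0 < Real.log T := by linarith
  have hη : 0 < etaF α T := by unfold etaF; positivity
  set ℓ := Real.log T with hℓdef
  have q : (ℓ ^ ((1:ℝ) / 4)) ^ 4 = ℓ := by
    rw [← Real.rpow_natCast, ← Real.rpow_mul hℓ0.le]; norm_num
  have q2 : (ℓ ^ ((1:ℝ) / 4)) ^ 2 = ℓ ^ ((1:ℝ) / 2) := by
    rw [← Real.rpow_natCast, ← Real.rpow_mul hℓ0.le]; norm_num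
  have q3 : (ℓ ^ ((1:ℝ) / 2)) ^ 2 = ℓ := by
    rw [← Real.rpow_natCast, ← Real.rpow_mul hℓ0.le]; norm_num
  have a4 : (T:ℝ) * ((T:ℝ) ^ (-((1 - α) / 4))) ^ 4 = (T:ℝ) ^ α := by
    rw [← Real.rpow_natCast, ← Real.rpow_mul hT0.le]
    nth_rewrite 1 [← Real.rpow_one (T:ℝ)]
    rw [← Real.rpow_add hT0]; congr 1; push_cast; ring
  have a2 : (T:ℝ) * ((T:ℝ) ^ (-((1 - α) / 4))) ^ 2 = (T:ℝ) ^ ((1 + α) * (1 / 2)) := by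
    rw [← Real.rpow_natCast, ← Real.rpow_mul hT0.le]
    nth_rewrite 1 [← Real.rpow_one (T:ℝ)]
    rw [← Real.rpow_add hT0]; congr 1; push_cast; ring
  have a1 : (T:ℝ) * ((T:ℝ) ^ (-((1 - α) / 4))) = (T:ℝ) ^ ((3 + α) / 4) := by
    nth_rewrite 1 [← Real.rpow_one (T:ℝ)]
    rw [← Real.rpow_add hT0]; congr 1; ring
  have hx : 0 < (T:ℝ) ^ (-((1 - α) / 4)) := by positivity
  have e2 : T * etaF α T ^ 4 = (T:ℝ) ^ α * ℓ := by
    unfold etaF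
    rw [mul_pow, ← mul_assoc, a4, q]
  have hημ : etaF α T ≤ muF α T := by
    rw [muF_eq α hℓ0]
    exact le_mul_of_one_le_right hη.le (Real.one_le_rpow hℓ (by norm_num))
  refine ⟨hη, hημ, e2.symm, ?_, ?_, ?_⟩
  · unfold etaF
    rw [mul_pow, ← mul_assoc, a2, q2, Real.rpow_mul hT0.le]
    have h1 : ℓ ^ ((1:ℝ) / 2) ≤ ((T:ℝ) ^ (1 + α)) ^ ((1:ℝ) / 2) :=
      Real.rpow_le_rpow hℓ0.le hlog (by norm_num)
    calc ℓ = ℓ ^ ((1:ℝ) / 2) * ℓ ^ ((1:ℝ) / 2) := by rw [← pow_two, q3]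
      _ ≤ _ := by gcongr
  · unfold muF
    rw [mul_pow, q3, ← a4]
    have ha : ((T:ℝ) ^ (-((1 - α) / 4))) ^ 4 ≤ ((T:ℝ) ^ (-((1 - α) / 4))) ^ 2 * ℓ := by
      have hb : (T:ℝ) ^ (-((1 - α) / 4)) ≤ 1 :=
        Real.rpow_le_one_of_one_le_of_nonpos hT1 (by linarith)
      have : ((T:ℝ) ^ (-((1 - α) / 4))) ^ 4 ≤ ((T:ℝ) ^ (-((1 - α) / 4))) ^ 2 :=
        pow_le_pow_of_le_one hx.le hb (by norm_num)
      nlinarith [sq_nonneg ((T:ℝ) ^ (-((1 - α) / 4)))]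
    gcongr
  · unfold muF
    rw [← mul_assoc, a1]

lemma eventually_small {f : ℕ → ℝ} (hf : Filter.Tendsto f Filter.atTop (nhds 0)) (K : ℝ)
    {e : ℝ} (he : 0 < e) : ∀ᶠ T in Filter.atTop, K * f T < e := by
  have h := hf.const_mul K
  rw [mul_zero] at h
  exact h.eventually (gt_mem_nhds he)

/-- `k ≥ 3` cuts, non-myopic Bob with public learning rate, upper bound:
for `k ≥ 3` and `α ∈ (-1, 1)`, for every Alice value density there is a deterministic Alice
strategy (depending on `α` but not on `c`) such that for every `c > 0` there are `C > 0` and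
`T₀` with: against every Bob value density and every Bob strategy guaranteeing regret at most
`c·T'^α` for all horizons, Alice's Stackelberg regret over any horizon `T ≥ T₀` is at most
`C·T^{(3+α)/4}·k^{3/4}·(log T)^{1/2}`. -/
theorem k_cut_public_rate_upper (δ Δ : ℝ) (hδ : 0 < δ) (hδΔ : δ ≤ Δ)
    (k : ℕ) (hk : 3 ≤ k) (α : ℝ) (hα₁ : -1 < α) (hα₂ : α < 1) :
    ∀ vA : ℝ → ℝ, IsValueDensity δ Δ vA →
      ∃ SA : AliceStrategy k, AliceValid k SA ∧
        ∀ c : ℝ, 0 < c →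
          ∃ (C : ℝ) (T₀ : ℕ), 0 < C ∧
            ∀ vB : ℝ → ℝ, IsValueDensity δ Δ vB →
              ∀ SB : BobStrategy k,
                BobGuarantees k vB SB (fun T' => c * (T' : ℝ) ^ α) →
                ∀ T : ℕ, T₀ ≤ T →
                  aliceRegret k vA vB SA SB T ≤
                    C * (T : ℝ) ^ ((3 + α) / 4) * (k : ℝ) ^ ((3 : ℝ) / 4) *
                      Real.log T ^ ((1 : ℝ) / 2) := by
  intro vA hA
  refine ⟨progStrat (fun T => learn k (repM α (etaF α T) T) (Nat.log 2 T + 1)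
      (fuelN δ (etaF α T)) (etaF α T))
    (fun T r => (best hδ hA k (est r) (muF α T)).1), fun T h => (head _ _).2, fun c hc => ?_⟩
  have hΔ : 0 < Δ := hδ.trans_le hδΔ
  have hμt := tendsto_muF hα₂
  have hlogt : ∀ᶠ T : ℕ in Filter.atTop, 1 ≤ Real.log T :=
    (Real.tendsto_log_atTop.comp tendsto_natCast_atTop_atTop).eventually_ge_atTop 1
  have hbig := tendsto_logpow.eventually_ge_atTop
    (2 * ((k + 1) * (2 * ((1 + Δ / δ) * (2 * (Δ + (c / 2 + Δ) * (9 + 12 / δ)))))))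
  obtain ⟨T₀, hT₀⟩ := Filter.eventually_atTop.1
    ((Filter.eventually_ge_atTop 1).and (hlogt.and ((eventually_log_le hα₁).and
      (hbig.and ((eventually_small hμt 1 one_pos).and
      ((eventually_small hμt (3 * (c / 2 + Δ)) (half_pos hδ)).and
      ((eventually_small hμt Δ (one_half_pos)).and
      ((eventually_small hμt ((c / 2 + Δ) * (4 + 6 / δ)) (one_half_pos)).and
      ((eventually_small hμt 2 (e := 1 / 4) (by norm_num)).and
      (eventually_small hμt (Δ * (2 / δ) * (k + 1)) (e := 1 / 4) (by norm_num)))))))))))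
  refine ⟨24 * (2 / δ + 2) + c + (1 + Δ * (2 / δ)), T₀, by positivity, ?_⟩
  intro vB hB SB hguar T hT
  obtain ⟨t1, t2, t3, t4, t5, t6, t7, t8, t9, t10⟩ := hT₀ T hT
  obtain ⟨hη, hημ, f2, f4, f5, hfin⟩ := eta_facts hα₂ t1 t2 t3
  have hℓ0 : 0 < Real.log T := by linarith
  have main := core_bound hδ hδΔ hA hB hk (α := α) hc (etaF α) (muF α) SB T _ rfl (hguar _ T)
    t1 t2 (natlog_le t1 t2) hη (by linarith) hημ f2 (t2.trans f4) f4 f5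
    ((mul_le_mul_of_nonneg_left hημ (by positivity)).trans t6.le)
    ((mul_le_mul_of_nonneg_left hημ (by positivity)).trans t7.le)
    ((mul_le_mul_of_nonneg_left hημ (by positivity)).trans_lt t8)
    (by
      rw [muF_eq α hℓ0]
      have := mul_le_mul_of_nonneg_left t4 hη.le
      linarith)
    t9.le
    (by
      have e : Δ * (2 * muF α T / δ) * (k + 1) = Δ * (2 / δ) * (k + 1) * muF α T := by ring
      rw [e]; exact t10.le)
  refine main.trans ?_
  rw [hfin]
  have hk1 : (1:ℝ) ≤ (k:ℝ) ^ ((3:ℝ) / 4) :=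
    Real.one_le_rpow (by exact_mod_cast (by omega : 1 ≤ k)) (by norm_num)
  have hX : 0 ≤ (24 * (2 / δ + 2) + c + (1 + Δ * (2 / δ))) *
      ((T:ℝ) ^ ((3 + α) / 4) * Real.log T ^ ((1:ℝ) / 2)) := by positivity
  calc _ ≤ (24 * (2 / δ + 2) + c + (1 + Δ * (2 / δ))) *
      ((T:ℝ) ^ ((3 + α) / 4) * Real.log T ^ ((1:ℝ) / 2)) * (k:ℝ) ^ ((3:ℝ) / 4) :=
        le_mul_of_one_le_right hX hk1
    _ = _ := by ring

end
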